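/- Let s > 0. Assume the standing assumptions, that μ satisfies the reverse doubling condition with exponent η = s, and that there is Q > s and c > 0 such that μ(B) ≥ c·rad(B)^Q for all balls B ⊂ X. Let ∅ ≠ E ⊂ X be a closed set, and let 1 < p ≤ q ≤ Qp/(Q−sp) < ∞ and β ∈ ℝ be such that codim_A(E) > max{ Q − (q/p)(Q−sp+β), β/(p−1) }. Then there is a constant C > 0 such that (∫_X (I_s f)(x)^q · δ_E(x)^{(q/p)(Q−sp+β)−Q} dμ(x))^{1/q} ≤ C (∫_X f(x)^p · δ_E(x)^β dμ(x))^{1/p} for all measurable functions f ≥ 0 on X. -/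

import Mathlib

open MeasureTheory Metric Set
open scoped ENNReal NNReal

namespace ApDistance

noncomputable section

variable {X : Type*} [MetricSpace X] [MeasurableSpace X] [BorelSpace X]

/-- All balls of positive radius have positive and finite measure. -/
def BallsPosFinite (μ : Measure X) : Prop :=
  ∀ (x : X) (r : ℝ), 0 < r → 0 < μ (ball x r) ∧ μ (ball x r) < ∞

/-- The measure `μ` is doubling with constant `C`. -/
def DoublingWith (μ : Measure X) (C : ℝ) : Prop :=
  ∀ (x : X) (r : ℝ), 0 < r → μ (ball x (2 * r)) ≤ ENNReal.ofReal C * μ (ball x r)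

/-- The measure `μ` is doubling. -/
def Doubling (μ : Measure X) : Prop :=
  ∃ C : ℝ, 0 < C ∧ DoublingWith μ C

/-- The (quantitative) reverse doubling condition with exponent `η`. -/
def ReverseDoubling (μ : Measure X) (η : ℝ) : Prop :=
  ∃ C : ℝ, 0 < C ∧ ∀ (x y : X) (r R : ℝ), 0 < r → 0 < R → ball y r ⊆ ball x R →
    μ (ball y r) ≤ ENNReal.ofReal (C * (r / R) ^ η) * μ (ball x R)

/-- Standing assumptions (S1)-(S2): `X` is unbounded, points have measure zero,
and all annuli are nonempty. -/
def StandingAssumptions (μ : Measure X) : Prop :=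
  ¬ Bornology.IsBounded (univ : Set X) ∧ (∀ x : X, μ {x} = 0) ∧
    ∀ (x : X) (r R : ℝ), 0 < r → r < R → (ball x R \ ball x r).Nonempty

/-- Ahlfors `Q`-regularity of the metric measure space. -/
def AhlforsRegular (μ : Measure X) (Q : ℝ) : Prop :=
  ∃ C : ℝ, 1 ≤ C ∧ ∀ (x : X) (r : ℝ), 0 < r → ENNReal.ofReal r < EMetric.diam (univ : Set X) →
    ENNReal.ofReal (C⁻¹ * r ^ Q) ≤ μ (ball x r) ∧ μ (ball x r) ≤ ENNReal.ofReal (C * r ^ Q)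

/-- The set of admissible exponents in the definition of the (upper) Assouad dimension:
`E ∩ B(x,R)` can be covered by at most `C (R/r)^s` balls of radius `r`. -/
def assouadDimBddSet (E : Set X) : Set ℝ :=
  {s : ℝ | 0 ≤ s ∧ ∃ C : ℝ, 1 ≤ C ∧ ∀ x ∈ E, ∀ r R : ℝ, 0 < r → r < R →
    ENNReal.ofReal R < 2 * EMetric.diam (univ : Set X) →
    ∃ F : Finset X, (F.card : ℝ) ≤ C * (R / r) ^ s ∧ E ∩ ball x R ⊆ ⋃ y ∈ F, ball y r}

/-- The (upper) Assouad dimension of a set `E`. -/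
def assouadDim (E : Set X) : ℝ := sInf (assouadDimBddSet E)

/-- The set of admissible exponents in the definition of the lower Assouad codimension. -/
def assouadCodimBddSet (μ : Measure X) (E : Set X) : Set ℝ :=
  {ρ : ℝ | 0 ≤ ρ ∧ ∃ C : ℝ, 1 ≤ C ∧ ∀ x ∈ E, ∀ r R : ℝ, 0 < r → r < R →
    ENNReal.ofReal R < 2 * EMetric.diam (univ : Set X) →
    μ ({y : X | infDist y E < r} ∩ ball x R) ≤
      ENNReal.ofReal (C * (r / R) ^ ρ) * μ (ball x R)}

/-- The lower Assouad codimension of a set `E` with respect to `μ`. -/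
def assouadCodim (μ : Measure X) (E : Set X) : ℝ := sSup (assouadCodimBddSet μ E)

/-- Porosity of a set `E ⊆ X`. -/
def IsPorous (E : Set X) : Prop :=
  ∃ c : ℝ, 0 < c ∧ c < 1 ∧ ∀ x ∈ E, ∀ r : ℝ, 0 < r →
    ENNReal.ofReal r < 2 * EMetric.diam (univ : Set X) →
    ∃ y : X, ball y (c * r) ⊆ ball x r \ E

/-- A weight: measurable, a.e. positive and finite, locally integrable on balls. -/
def IsWeight (μ : Measure X) (w : X → ℝ≥0∞) : Prop :=
  Measurable w ∧ (∀ᵐ x ∂μ, 0 < w x ∧ w x ≠ ∞) ∧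
    ∀ (x : X) (r : ℝ), 0 < r → ∫⁻ y in ball x r, w y ∂μ ≠ ∞

/-- Membership in the Muckenhoupt class `A_p`, `1 < p < ∞`. -/
def MemAp (μ : Measure X) (w : X → ℝ≥0∞) (p : ℝ) : Prop :=
  IsWeight μ w ∧ ∃ A : ℝ, 0 < A ∧ ∀ (x : X) (r : ℝ), 0 < r →
    ((∫⁻ y in ball x r, w y ∂μ) / μ (ball x r)) *
      ((∫⁻ y in ball x r, w y ^ (-(1 / (p - 1))) ∂μ) / μ (ball x r)) ^ (p - 1) ≤
      ENNReal.ofReal A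

/-- Membership in the Muckenhoupt class `A_1`. -/
def MemA1 (μ : Measure X) (w : X → ℝ≥0∞) : Prop :=
  IsWeight μ w ∧ ∃ A : ℝ, 0 < A ∧ ∀ (x : X) (r : ℝ), 0 < r →
    ((∫⁻ y in ball x r, w y ∂μ) / μ (ball x r)) *
      essSup (fun y => (w y)⁻¹) (μ.restrict (ball x r)) ≤ ENNReal.ofReal A

/-- Membership in the Muckenhoupt class `A_∞`. -/
def MemAinfty (μ : Measure X) (w : X → ℝ≥0∞) : Prop :=
  IsWeight μ w ∧ ∃ C d : ℝ, 0 < C ∧ 0 < d ∧ ∀ (x : X) (r : ℝ), 0 < r →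
    ∀ F : Set X, MeasurableSet F → F ⊆ ball x r →
      ∫⁻ y in F, w y ∂μ ≤
        ENNReal.ofReal C * (μ F / μ (ball x r)) ^ d * ∫⁻ y in ball x r, w y ∂μ

/-- The weight `w = δ_E^{-α} = dist(·,E)^{-α}` (with values in `ℝ≥0∞`). -/
def distWeight (E : Set X) (α : ℝ) : X → ℝ≥0∞ :=
  fun x => ENNReal.ofReal (infDist x E) ^ (-α)

/-- The Aikawa condition with exponent `α` and constant `C`. -/
def AikawaCondition (μ : Measure X) (E : Set X) (α C : ℝ) : Prop :=
  ∀ x ∈ E, ∀ r : ℝ, 0 < r → ENNReal.ofReal r < 2 * EMetric.diam (univ : Set X) →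
    ∫⁻ y in ball x r, ENNReal.ofReal (infDist y E) ^ (-α) ∂μ ≤
      ENNReal.ofReal (C * r ^ (-α)) * μ (ball x r)

/-- The Riesz potential `I_s f`. -/
def rieszPotential (μ : Measure X) (s : ℝ) (f : X → ℝ≥0∞) (x : X) : ℝ≥0∞ :=
  ∫⁻ y, f y * ENNReal.ofReal (dist x y ^ s) / μ (ball x (dist x y)) ∂μ

/-- `Lip_0(X)`: Lipschitz functions vanishing outside some ball. -/
def MemLip0 (f : X → ℝ) : Prop :=
  (∃ K : ℝ≥0, LipschitzWith K f) ∧ ∃ (x : X) (r : ℝ), ∀ y : X, y ∉ ball x r → f y = 0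

/-- The `λ`-chain condition. -/
def ChainCondition (X : Type*) [MetricSpace X] (lam : ℝ) : Prop :=
  ∃ M : ℝ, 1 ≤ M ∧ ∀ (x : X) (r R : ℝ), 0 < r → r < R →
    ∃ (k : ℕ) (c : ℕ → X) (ρ : ℕ → ℝ),
      (∀ i ≤ k, 0 < ρ i) ∧
      ball (c 0) (lam * ρ 0) ⊆ (ball x R)ᶜ ∧
      ball (c k) (lam * ρ k) ⊆ ball x r ∧
      (∀ i ≤ k,
        M⁻¹ * Metric.diam (ball (c i) (lam * ρ i)) ≤ infDist x (ball (c i) (lam * ρ i)) ∧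
        infDist x (ball (c i) (lam * ρ i)) ≤ M * Metric.diam (ball (c i) (lam * ρ i))) ∧
      (∀ i < k, ∃ (z : X) (t : ℝ), 0 < t ∧
        ball z t ⊆ ball (c i) (ρ i) ∩ ball (c (i + 1)) (ρ (i + 1)) ∧
        ball (c i) (ρ i) ∪ ball (c (i + 1)) (ρ (i + 1)) ⊆ ball z (M * t)) ∧
      (∀ y : X, (({i : ℕ | i ≤ k ∧ y ∈ ball (c i) (lam * ρ i)}).ncard : ℝ) ≤ M)

/-- The inner integral appearing in fractional Hardy–Sobolev inequalities:
`y ↦ ∫_X |f(y)-f(z)|^t / (d(y,z)^{st} μ(B(y,d(y,z)))) dμ(z)`. -/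
def fracEnergyKernel (μ : Measure X) (s t : ℝ) (f : X → ℝ) (y : X) : ℝ≥0∞ :=
  ∫⁻ z, ENNReal.ofReal (|f y - f z| ^ t) /
    (ENNReal.ofReal (dist y z ^ (s * t)) * μ (ball y (dist y z))) ∂μ


/-- comparison of powers of comparable numbers -/
lemma rpow_comp {t d : ℝ} (e : ℝ) (ht : 0 < t) (h1 : t / 2 ≤ d) (h2 : d ≤ 2 * t) :
    d ^ e ≤ 2 ^ |e| * t ^ e := by
  have hd : 0 < d := by linarith
  have key : (d / t) ^ e ≤ 2 ^ |e| := by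
    have h3 : d / t ≤ 2 := by rw [div_le_iff₀ ht]; exact h2
    have h4 : 1 / 2 ≤ d / t := by rw [le_div_iff₀ ht]; linarith
    have hp : 0 < d / t := by positivity
    rcases le_total 0 e with he | he
    · rw [abs_of_nonneg he]
      exact Real.rpow_le_rpow hp.le h3 he
    · rw [abs_of_nonpos he]
      calc (d / t) ^ e ≤ (1 / 2 : ℝ) ^ e := Real.rpow_le_rpow_of_nonpos (by norm_num) h4 he
        _ = 2 ^ (-e) := by
          rw [Real.rpow_neg (by norm_num), one_div, Real.inv_rpow (by norm_num)]
  rw [Real.div_rpow hd.le ht.le, div_le_iff₀ (Real.rpow_pos_of_pos ht e)] at key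
  exact key

lemma geom_const_ne_top {γ : ℝ} (hγ : γ < 0) :
    (1 - ENNReal.ofReal ((2 : ℝ) ^ γ))⁻¹ ≠ ∞ := by
  rw [Ne, ENNReal.inv_eq_top, tsub_eq_zero_iff_le, not_le]
  rw [show (1 : ℝ≥0∞) = ENNReal.ofReal 1 by simp]
  apply (ENNReal.ofReal_lt_ofReal_iff (by norm_num)).2
  exact Real.rpow_lt_one_of_one_lt_of_neg (by norm_num) hγ

lemma tsum_geom (N : ℝ≥0∞) {t0 : ℝ} (ht0 : 0 < t0) (γ ε : ℝ) :
    ∑' n : ℕ, N * (ENNReal.ofReal (t0 ^ γ) * ENNReal.ofReal ((2 : ℝ) ^ ε) ^ n) =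
      N * (1 - ENNReal.ofReal ((2 : ℝ) ^ ε))⁻¹ * ENNReal.ofReal (t0 ^ γ) := by
  rw [ENNReal.tsum_mul_left, ENNReal.tsum_mul_left, ENNReal.tsum_geometric]
  ring

lemma sum_up {μ : Measure X} (h : X → ℝ) (φ : X → ℝ≥0∞) {γ : ℝ}
    (N : ℝ≥0∞) {t0 : ℝ} (ht0 : 0 < t0)
    (H : ∀ t, t0 ≤ t → ∫⁻ y in {y | t ≤ h y ∧ h y ≤ 2 * t}, φ y ∂μ ≤ N * ENNReal.ofReal (t ^ γ)) :
    ∫⁻ y in {y | t0 ≤ h y}, φ y ∂μ ≤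
      N * (1 - ENNReal.ofReal ((2 : ℝ) ^ γ))⁻¹ * ENNReal.ofReal (t0 ^ γ) := by
  have hsub : {y | t0 ≤ h y} ⊆
      ⋃ n : ℕ, {y | 2 ^ n * t0 ≤ h y ∧ h y ≤ 2 * (2 ^ n * t0)} := by
    intro y hy
    obtain ⟨n, h1, h2⟩ := exists_nat_pow_near (x := h y / t0) (y := 2)
      (by rw [le_div_iff₀ ht0]; simpa using hy) (by norm_num)
    rw [le_div_iff₀ ht0] at h1
    rw [div_lt_iff₀ ht0] at h2
    refine mem_iUnion.2 ⟨n, h1, ?_⟩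
    rw [pow_succ] at h2
    linarith
  calc _ ≤ ∫⁻ y in ⋃ n : ℕ, {y | 2 ^ n * t0 ≤ h y ∧ h y ≤ 2 * (2 ^ n * t0)}, φ y ∂μ :=
        lintegral_mono_set hsub
    _ ≤ ∑' n : ℕ, ∫⁻ y in {y | 2 ^ n * t0 ≤ h y ∧ h y ≤ 2 * (2 ^ n * t0)}, φ y ∂μ :=
        lintegral_iUnion_le _ _
    _ ≤ ∑' n : ℕ, N * (ENNReal.ofReal (t0 ^ γ) * ENNReal.ofReal ((2 : ℝ) ^ γ) ^ n) := by
        refine ENNReal.tsum_le_tsum fun n => ?_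
        refine (H (2 ^ n * t0) ?_).trans (le_of_eq ?_)
        · have : (1 : ℝ) ≤ 2 ^ n := one_le_pow₀ (by norm_num)
          nlinarith
        · congr 1
          rw [← ENNReal.ofReal_pow (by positivity), ← ENNReal.ofReal_mul (by positivity),
            Real.mul_rpow (by positivity) ht0.le, mul_comm]
          congr 2
          rw [← Real.rpow_natCast, ← Real.rpow_natCast, ← Real.rpow_mul (by norm_num),
            ← Real.rpow_mul (by norm_num), mul_comm]
    _ = _ := tsum_geom N ht0 γ γ

lemma sum_down {μ : Measure X} (h : X → ℝ) (φ : X → ℝ≥0∞) {γ : ℝ} (hγ : 0 ≤ γ)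
    (N : ℝ≥0∞) {t0 : ℝ} (ht0 : 0 < t0)
    (H : ∀ t, 0 < t → t ≤ t0 →
      ∫⁻ y in {y | t ≤ h y ∧ h y ≤ 2 * t}, φ y ∂μ ≤ N * ENNReal.ofReal (t ^ γ)) :
    ∫⁻ y in {y | 0 < h y ∧ h y ≤ t0}, φ y ∂μ ≤
      N * (1 - ENNReal.ofReal ((2 : ℝ) ^ (-γ)))⁻¹ * ENNReal.ofReal (t0 ^ γ) := by
  have hsub : {y | 0 < h y ∧ h y ≤ t0} ⊆
      ⋃ n : ℕ, {y | (1 / 2) ^ (n + 1) * t0 ≤ h y ∧ h y ≤ 2 * ((1 / 2) ^ (n + 1) * t0)} := by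
    rintro y ⟨hy0, hy⟩
    obtain ⟨n, h1, h2⟩ := exists_nat_pow_near_of_lt_one (x := h y / t0) (y := 1 / 2)
      (by positivity) (by rw [div_le_iff₀ ht0]; simpa using hy) (by norm_num) (by norm_num)
    rw [lt_div_iff₀ ht0] at h1
    rw [div_le_iff₀ ht0] at h2
    refine mem_iUnion.2 ⟨n, h1.le, ?_⟩
    rw [pow_succ]
    linarith
  calc _ ≤ ∫⁻ y in ⋃ n : ℕ, {y | (1 / 2) ^ (n + 1) * t0 ≤ h y ∧
            h y ≤ 2 * ((1 / 2) ^ (n + 1) * t0)}, φ y ∂μ :=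
        lintegral_mono_set hsub
    _ ≤ ∑' n : ℕ, ∫⁻ y in {y | (1 / 2) ^ (n + 1) * t0 ≤ h y ∧
            h y ≤ 2 * ((1 / 2) ^ (n + 1) * t0)}, φ y ∂μ :=
        lintegral_iUnion_le _ _
    _ ≤ ∑' n : ℕ, N * (ENNReal.ofReal (t0 ^ γ) * ENNReal.ofReal ((2 : ℝ) ^ (-γ)) ^ n) := by
        refine ENNReal.tsum_le_tsum fun n => ?_
        refine (H ((1 / 2) ^ (n + 1) * t0) (by positivity) ?_).trans ?_
        · have : (1 / 2 : ℝ) ^ (n + 1) ≤ 1 := pow_le_one₀ (by norm_num) (by norm_num)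
          nlinarith
        · gcongr
          rw [← ENNReal.ofReal_pow (by positivity), ← ENNReal.ofReal_mul (by positivity)]
          apply ENNReal.ofReal_le_ofReal
          calc ((1 / 2) ^ (n + 1) * t0) ^ γ ≤ ((1 / 2) ^ n * t0) ^ γ := by
                apply Real.rpow_le_rpow (by positivity) _ hγ
                rw [pow_succ]
                have : (0 : ℝ) < (1 / 2) ^ n * t0 := by positivity
                linarith
            _ = t0 ^ γ * (2 ^ (-γ)) ^ n := by
                rw [Real.mul_rpow (by positivity) ht0.le, mul_comm]
                congr 1
                rw [one_div, inv_pow, Real.inv_rpow (by positivity), ← Real.rpow_natCast,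
                  ← Real.rpow_natCast, ← Real.rpow_mul (by norm_num),
                  ← Real.rpow_mul (by norm_num), ← Real.rpow_neg (by norm_num)]
                congr 1; ring
    _ = _ := tsum_geom N ht0 γ (-γ)

/-- Single annulus estimate. -/
lemma annulus {μ : Measure X} (hb : BallsPosFinite μ) {K : ℝ≥0∞}
    (hK : ∀ (x : X) (r : ℝ), 0 < r → μ (ball x (2 * r)) ≤ K * μ (ball x r))
    (W : X → ℝ≥0∞) (x : X) (e α : ℝ) (N : ℝ≥0∞) {t : ℝ} (ht : 0 < t)
    (H : ∫⁻ y in ball x (4 * t), W y ∂μ ≤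
      N * ENNReal.ofReal ((4 * t) ^ (-α)) * μ (ball x (4 * t))) :
    ∫⁻ y in {y | t ≤ dist x y ∧ dist x y ≤ 2 * t},
      ENNReal.ofReal (dist x y ^ e) / μ (ball x (dist x y)) * W y ∂μ ≤
      (ENNReal.ofReal (2 ^ |e| * 4 ^ (-α)) * K ^ 2 * N) * ENNReal.ofReal (t ^ (e - α)) := by
  have hm : MeasurableSet {y : X | t ≤ dist x y ∧ dist x y ≤ 2 * t} := by
    apply IsClosed.measurableSet
    have hc : Continuous fun y : X => dist x y := by fun_prop
    exact (isClosed_le continuous_const hc).inter (isClosed_le hc continuous_const)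
  have hμ0 := (hb x t ht).1.ne'
  have hμt := (hb x t ht).2.ne
  have h4 : μ (ball x (4 * t)) ≤ K ^ 2 * μ (ball x t) := by
    calc μ (ball x (4 * t)) = μ (ball x (2 * (2 * t))) := by ring_nf
      _ ≤ K * μ (ball x (2 * t)) := hK x _ (by linarith)
      _ ≤ K * (K * μ (ball x t)) := by gcongr; exact hK x _ ht
      _ = _ := by ring
  have hfin : ENNReal.ofReal (2 ^ |e| * t ^ e) / μ (ball x t) ≠ ∞ :=
    ENNReal.div_ne_top ENNReal.ofReal_ne_top hμ0
  calc _ ≤ ∫⁻ y in {y | t ≤ dist x y ∧ dist x y ≤ 2 * t},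
        (ENNReal.ofReal (2 ^ |e| * t ^ e) / μ (ball x t)) * W y ∂μ := by
        refine setLIntegral_mono' hm fun y hy => ?_
        gcongr
        · exact rpow_comp e ht (by linarith [hy.1]) hy.2
        · exact hy.1
    _ = (ENNReal.ofReal (2 ^ |e| * t ^ e) / μ (ball x t)) *
          ∫⁻ y in {y | t ≤ dist x y ∧ dist x y ≤ 2 * t}, W y ∂μ :=
        lintegral_const_mul' _ _ hfin
    _ ≤ (ENNReal.ofReal (2 ^ |e| * t ^ e) / μ (ball x t)) *
          ∫⁻ y in ball x (4 * t), W y ∂μ := by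
        gcongr
        intro y hy
        rw [mem_ball, dist_comm]
        linarith [hy.2]
    _ ≤ (ENNReal.ofReal (2 ^ |e| * t ^ e) / μ (ball x t)) *
          (N * ENNReal.ofReal ((4 * t) ^ (-α)) * (K ^ 2 * μ (ball x t))) := by
        gcongr
        exact H.trans (by gcongr)
    _ = ENNReal.ofReal (2 ^ |e| * t ^ e) * ENNReal.ofReal ((4 * t) ^ (-α)) * K ^ 2 * N *
          (μ (ball x t) / μ (ball x t)) := by
        simp only [div_eq_mul_inv]; ring
    _ = _ := by
        rw [ENNReal.div_self hμ0 hμt, mul_one, ← ENNReal.ofReal_mul (by positivity)]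
        rw [show (2 ^ |e| * t ^ e * (4 * t) ^ (-α) : ℝ) = 2 ^ |e| * 4 ^ (-α) * t ^ (e - α) by
          rw [Real.mul_rpow (by norm_num) ht.le, sub_eq_add_neg, Real.rpow_add ht]; ring]
        rw [ENNReal.ofReal_mul (by positivity)]
        ring

/-- Far estimate. -/
lemma far_bound {μ : Measure X} (hb : BallsPosFinite μ) {K : ℝ≥0∞}
    (hK : ∀ (x : X) (r : ℝ), 0 < r → μ (ball x (2 * r)) ≤ K * μ (ball x r))
    (W : X → ℝ≥0∞) (x : X) (e α : ℝ) (N : ℝ≥0∞) {t0 : ℝ} (ht0 : 0 < t0)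
    (H : ∀ t, t0 ≤ t → ∫⁻ y in ball x t, W y ∂μ ≤
      N * ENNReal.ofReal (t ^ (-α)) * μ (ball x t)) :
    ∫⁻ y in {y | t0 ≤ dist x y},
      ENNReal.ofReal (dist x y ^ e) / μ (ball x (dist x y)) * W y ∂μ ≤
      (ENNReal.ofReal (2 ^ |e| * 4 ^ (-α)) * K ^ 2 * N) *
        (1 - ENNReal.ofReal ((2 : ℝ) ^ (e - α)))⁻¹ * ENNReal.ofReal (t0 ^ (e - α)) :=
  sum_up _ _ _ ht0 fun t ht => annulus hb hK W x e α N (by linarith) (H _ (by linarith))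

/-- Near estimate. -/
lemma near_bound {μ : Measure X} (hb : BallsPosFinite μ) {K : ℝ≥0∞}
    (hK : ∀ (x : X) (r : ℝ), 0 < r → μ (ball x (2 * r)) ≤ K * μ (ball x r))
    (W : X → ℝ≥0∞) (x : X) {e : ℝ} (he : 0 ≤ e) (N : ℝ≥0∞) {t0 : ℝ} (ht0 : 0 < t0)
    (H : ∀ t, 0 < t → ∫⁻ y in ball x t, W y ∂μ ≤ N * μ (ball x t)) :
    ∫⁻ y in {y | 0 < dist x y ∧ dist x y ≤ t0},
      ENNReal.ofReal (dist x y ^ e) / μ (ball x (dist x y)) * W y ∂μ ≤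
      (ENNReal.ofReal (2 ^ |e|) * K ^ 2 * N) *
        (1 - ENNReal.ofReal ((2 : ℝ) ^ (-e)))⁻¹ * ENNReal.ofReal (t0 ^ e) :=
  sum_down _ _ he _ ht0 fun t ht _ => by
    have := annulus hb hK W x e 0 N ht (by simpa using H (4 * t) (by linarith))
    simpa using this

/-- Local integrability of powers of the distance (Aikawa condition). -/
lemma aikawa {μ : Measure X} (hb : BallsPosFinite μ) {K : ℝ≥0∞} (hKt : K ≠ ∞)
    (hK : ∀ (x : X) (r : ℝ), 0 < r → μ (ball x (2 * r)) ≤ K * μ (ball x r))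
    {E : Set X} (hE : E.Nonempty) (hE0 : ∀ᵐ y ∂μ, 0 < infDist y E) {ρ : ℝ} (A : ℝ)
    (hρ : ∀ x ∈ E, ∀ r R : ℝ, 0 < r → r < R →
      μ ({y : X | infDist y E < r} ∩ ball x R) ≤
      ENNReal.ofReal (A * (r / R) ^ ρ) * μ (ball x R)) (hA : 0 ≤ A)
    {α : ℝ} (hα : α < ρ) :
    ∃ N : ℝ≥0∞, N ≠ ∞ ∧ ∀ (x : X) (t : ℝ), 0 < t → infDist x E ≤ 3 * t →
      ∫⁻ y in ball x t, ENNReal.ofReal (infDist y E ^ (-α)) ∂μ ≤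
        N * ENNReal.ofReal (t ^ (-α)) * μ (ball x t) := by
  refine ⟨ENNReal.ofReal (2 ^ |(-α)| * A * 10 ^ (-ρ) * 5 ^ (ρ - α)) * K ^ 6 *
    (1 - ENNReal.ofReal ((2 : ℝ) ^ (-(ρ - α))))⁻¹, ?_, ?_⟩
  · exact ENNReal.mul_ne_top (ENNReal.mul_ne_top ENNReal.ofReal_ne_top (ENNReal.pow_ne_top hKt))
      (geom_const_ne_top (by linarith))
  intro x t ht hx
  obtain ⟨z, hz, hxz⟩ := (infDist_lt_iff hE).1 (show infDist x E < 4 * t by linarith)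
  have hδ : ∀ y ∈ ball x t, infDist y E ≤ 5 * t := by
    intro y hy
    have := infDist_le_dist_of_mem (x := y) hz
    have h2 := dist_triangle y x z
    rw [mem_ball] at hy
    linarith
  have hsub : ball x t ⊆ ball z (10 * t) := by
    intro y hy
    rw [mem_ball] at *
    linarith [dist_triangle y x z]
  have hbig : μ (ball z (10 * t)) ≤ K ^ 4 * μ (ball x t) := by
    calc μ (ball z (10 * t)) ≤ μ (ball x (2 * (2 * (2 * (2 * t))))) := by
          apply measure_mono
          intro y hy
          rw [mem_ball] at *
          have := dist_triangle y z x
          rw [dist_comm z x] at this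
          linarith
      _ ≤ K * (K * (K * (K * μ (ball x t)))) := by
          refine (hK x _ (by linarith)).trans ?_
          gcongr
          refine (hK x _ (by linarith)).trans ?_
          gcongr
          refine (hK x _ (by linarith)).trans ?_
          gcongr
          exact hK x _ ht
      _ = _ := by ring
  have hbig2 : μ (ball z (40 * t)) ≤ K ^ 6 * μ (ball x t) := by
    calc μ (ball z (40 * t)) = μ (ball z (2 * (2 * (10 * t)))) := by ring_nf
      _ ≤ K * (K * μ (ball z (10 * t))) := by
          refine (hK _ _ (by linarith)).trans ?_
          gcongr
          exact hK _ _ (by linarith)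
      _ ≤ K * (K * (K ^ 4 * μ (ball x t))) := by gcongr
      _ = _ := by ring
  have key := sum_down (μ := μ.restrict (ball x t)) (fun y => infDist y E)
    (fun y => ENNReal.ofReal (infDist y E ^ (-α))) (γ := ρ - α) (by linarith)
    (ENNReal.ofReal (2 ^ |(-α)| * A * (10 * t) ^ (-ρ)) * K ^ 6 * μ (ball x t))
    (t0 := 5 * t) (by linarith) (by
      intro τ hτ hτ2
      have hm : MeasurableSet {y : X | τ ≤ infDist y E ∧ infDist y E ≤ 2 * τ} := by
        apply IsClosed.measurableSet
        have hc := continuous_infDist_pt E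
        exact (isClosed_le continuous_const hc).inter (isClosed_le hc continuous_const)
      calc _ ≤ ∫⁻ y in {y | τ ≤ infDist y E ∧ infDist y E ≤ 2 * τ},
            ENNReal.ofReal (2 ^ |(-α)| * τ ^ (-α)) ∂(μ.restrict (ball x t)) := by
            refine setLIntegral_mono' hm fun y hy => ?_
            apply ENNReal.ofReal_le_ofReal
            exact rpow_comp _ hτ (by linarith [hy.1]) hy.2
        _ = ENNReal.ofReal (2 ^ |(-α)| * τ ^ (-α)) *
            μ ({y | τ ≤ infDist y E ∧ infDist y E ≤ 2 * τ} ∩ ball x t) := by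
            rw [setLIntegral_const, Measure.restrict_apply hm]
        _ ≤ ENNReal.ofReal (2 ^ |(-α)| * τ ^ (-α)) *
            μ ({y | infDist y E < 4 * τ} ∩ ball z (40 * t)) := by
            gcongr
            · intro hy
              linarith [hy.2]
            · exact hsub.trans (ball_subset_ball (by linarith))
        _ ≤ ENNReal.ofReal (2 ^ |(-α)| * τ ^ (-α)) *
            (ENNReal.ofReal (A * ((4 * τ) / (40 * t)) ^ ρ) * (K ^ 6 * μ (ball x t))) := by
            gcongr
            exact (hρ z hz _ _ (by linarith) (by linarith)).trans (by gcongr)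
        _ = ENNReal.ofReal (2 ^ |(-α)| * τ ^ (-α)) *
            ENNReal.ofReal (A * ((4 * τ) / (40 * t)) ^ ρ) * K ^ 6 * μ (ball x t) := by ring
        _ = ENNReal.ofReal (2 ^ |(-α)| * A * (10 * t) ^ (-ρ)) * ENNReal.ofReal (τ ^ (ρ - α)) *
            K ^ 6 * μ (ball x t) := by
            rw [← ENNReal.ofReal_mul (by positivity), ← ENNReal.ofReal_mul (by positivity)]
            congr 3
            rw [show (4 * τ) / (40 * t) = τ / (10 * t) by field_simp; norm_num,
              Real.div_rpow hτ.le (by positivity), Real.rpow_neg (by positivity : 0 ≤ 10 * t),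
              sub_eq_add_neg, Real.rpow_add hτ, div_eq_mul_inv]
            ring
        _ = _ := by ring)
  calc _ ≤ ∫⁻ y in {y | 0 < infDist y E ∧ infDist y E ≤ 5 * t},
        ENNReal.ofReal (infDist y E ^ (-α)) ∂(μ.restrict (ball x t)) := by
        have hset : ({y | 0 < infDist y E ∧ infDist y E ≤ 5 * t} : Set X)
            =ᵐ[μ.restrict (ball x t)] univ := by
          rw [Filter.eventuallyEq_univ]
          filter_upwards [ae_restrict_of_ae hE0, ae_restrict_mem measurableSet_ball] with y h1 h2
          exact ⟨h1, hδ y h2⟩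
        rw [setLIntegral_congr hset, Measure.restrict_univ]
    _ ≤ _ := key
    _ = ENNReal.ofReal (2 ^ |(-α)| * A * (10 * t) ^ (-ρ)) * ENNReal.ofReal ((5 * t) ^ (ρ - α)) *
        K ^ 6 * (1 - ENNReal.ofReal ((2 : ℝ) ^ (-(ρ - α))))⁻¹ * μ (ball x t) := by ring
    _ = ENNReal.ofReal (2 ^ |(-α)| * A * 10 ^ (-ρ) * 5 ^ (ρ - α)) * ENNReal.ofReal (t ^ (-α)) *
        K ^ 6 * (1 - ENNReal.ofReal ((2 : ℝ) ^ (-(ρ - α))))⁻¹ * μ (ball x t) := by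
        rw [← ENNReal.ofReal_mul (by positivity), ← ENNReal.ofReal_mul (by positivity)]
        congr 4
        rw [Real.mul_rpow (by norm_num) ht.le, Real.mul_rpow (by norm_num) ht.le,
          show t ^ (-α) = t ^ (-ρ) * t ^ (ρ - α) by rw [← Real.rpow_add ht]; congr 1; ring]
        ring
    _ = _ := by ring

/-- The space is separable. -/
lemma secondCountable_of_balls {μ : Measure X} (hb : BallsPosFinite μ) [SFinite μ] :
    SecondCountableTopology X := by
  refine Metric.secondCountable_of_almost_dense_set fun ε hε => ?_
  obtain ⟨u, -, hd, hc⟩ := Vitali.exists_disjoint_subfamily_covering_enlargement_closedBall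
    (univ : Set X) id (fun _ => ε / 5) (ε / 5) (fun _ _ => le_rfl) 5 (by norm_num)
  refine ⟨u, ?_, fun x => ?_⟩
  · have := Measure.countable_meas_pos_of_disjoint_iUnion (μ := μ) (ι := u)
      (As := fun a => closedBall (a : X) (ε / 5)) (fun _ => measurableSet_closedBall)
      (fun a b hab => hd a.2 b.2 (fun h => hab (Subtype.ext h)))
    have huniv : {i : u | 0 < μ (closedBall (i : X) (ε / 5))} = univ := by
      ext i
      simp only [mem_ofPred_eq, mem_univ, iff_true]
      exact (hb i (ε / 5) (by positivity)).1.trans_le (measure_mono ball_subset_closedBall)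
    rw [huniv] at this
    exact countable_coe_iff.1 (countable_univ_iff.1 this)
  · obtain ⟨b, hbu, hsub⟩ := hc x (mem_univ _)
    refine ⟨b, hbu, ?_⟩
    have := hsub (mem_closedBall_self (by positivity))
    rw [mem_closedBall] at this
    simp only [id] at this
    linarith

lemma sigmaFinite_of_balls {μ : Measure X} (hb : BallsPosFinite μ) [Nonempty X] :
    SigmaFinite μ := by
  obtain ⟨x⟩ := ‹Nonempty X›
  refine ⟨⟨⟨fun n => ball x (n + 1), fun _ => trivial, fun n => (hb x _ (by positivity)).2, ?_⟩⟩⟩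
  refine eq_univ_of_forall fun y => ?_
  obtain ⟨n, hn⟩ := exists_nat_gt (dist y x)
  exact mem_iUnion.2 ⟨n, by rw [mem_ball]; linarith⟩
/-- centred Hardy-Littlewood maximal function -/
def maxFn (μ : Measure X) (g : X → ℝ≥0∞) (x : X) : ℝ≥0∞ :=
  ⨆ (r : ℝ) (_ : 0 < r), (∫⁻ y in ball x r, g y ∂μ) / μ (ball x r)

lemma le_maxFn {μ : Measure X} (hb : BallsPosFinite μ) (g : X → ℝ≥0∞) (x : X) {t : ℝ}
    (ht : 0 < t) : ∫⁻ y in ball x t, g y ∂μ ≤ maxFn μ g x * μ (ball x t) := by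
  have h : (∫⁻ y in ball x t, g y ∂μ) / μ (ball x t) ≤ maxFn μ g x :=
    le_iSup₂ (f := fun (r : ℝ) (_ : 0 < r) => (∫⁻ y in ball x r, g y ∂μ) / μ (ball x r)) t ht
  rwa [ENNReal.div_le_iff (hb x t ht).1.ne' (hb x t ht).2.ne] at h

lemma weak_type {μ : Measure X} [SFinite μ] (hb : BallsPosFinite μ) {K : ℝ≥0∞}
    (hK : ∀ (x : X) (r : ℝ), 0 < r → μ (ball x (2 * r)) ≤ K * μ (ball x r))
    {Q c : ℝ} (hQ : 0 < Q) (hc : 0 < c)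
    (hlow : ∀ (x : X) (r : ℝ), 0 < r → ENNReal.ofReal (c * r ^ Q) ≤ μ (ball x r))
    (hKt : K ≠ ∞) (hK0 : K ≠ 0)
    (g : X → ℝ≥0∞) {l : ℝ≥0∞} (hl : l ≠ 0) (hlt : l ≠ ∞) :
    l * μ {x | l < maxFn μ g x} ≤ K ^ 3 * ∫⁻ y, g y ∂μ := by
  rcases eq_or_ne (∫⁻ y, g y ∂μ) ∞ with hI | hI
  · rw [hI, ENNReal.mul_top (pow_ne_zero _ hK0)]; exact le_top
  set S := {x | l < maxFn μ g x} with hS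
  have hex : ∀ x : S, ∃ r : ℝ, 0 < r ∧
      l * μ (ball (x : X) r) ≤ ∫⁻ y in ball (x : X) r, g y ∂μ := by
    rintro ⟨x, hx⟩
    change l < maxFn μ g x at hx
    unfold maxFn at hx
    simp only [lt_iSup_iff] at hx
    obtain ⟨r, hr, h⟩ := hx
    refine ⟨r, hr, ?_⟩
    rw [ENNReal.lt_div_iff_mul_lt (Or.inl (hb x r hr).1.ne') (Or.inl (hb x r hr).2.ne)] at h
    exact h.le
  choose r hr0 hr using hex
  have hbd : ∀ x : S, r x ≤ ((∫⁻ y, g y ∂μ).toReal / (l.toReal * c)) ^ (1 / Q) := by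
    intro x
    have h1 : l * ENNReal.ofReal (c * r x ^ Q) ≤ ∫⁻ y, g y ∂μ := by
      calc _ ≤ l * μ (ball (x : X) (r x)) := by gcongr; exact hlow _ _ (hr0 x)
        _ ≤ _ := (hr x).trans (setLIntegral_le_lintegral _ _)
    have h2 := ENNReal.toReal_mono hI h1
    have hrx := hr0 x
    rw [ENNReal.toReal_mul, ENNReal.toReal_ofReal (by positivity)] at h2
    have hlp : 0 < l.toReal := ENNReal.toReal_pos hl hlt
    have h3 : r x ^ Q ≤ (∫⁻ y, g y ∂μ).toReal / (l.toReal * c) := by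
      rw [le_div_iff₀ (by positivity)]
      linarith
    calc r x = (r x ^ Q) ^ (1 / Q) := by
          rw [← Real.rpow_mul hrx.le, mul_one_div_cancel hQ.ne', Real.rpow_one]
      _ ≤ _ := Real.rpow_le_rpow (by positivity) h3 (by positivity)
  obtain ⟨u, -, hd, hcov⟩ := Vitali.exists_disjoint_subfamily_covering_enlargement_closedBall
    (univ : Set S) (fun a => (a : X)) r _ (fun a _ => hbd a) 5 (by norm_num)
  have hd' : u.PairwiseDisjoint fun a : S => ball (a : X) (r a) :=
    hd.mono fun a => ball_subset_closedBall
  have hucount : u.Countable := by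
    have := Measure.countable_meas_pos_of_disjoint_iUnion (μ := μ) (ι := u)
      (As := fun a => ball ((a : S) : X) (r a)) (fun _ => measurableSet_ball)
      (fun a b hab => hd' a.2 b.2 (fun h => hab (Subtype.ext h)))
    have huniv : {i : u | 0 < μ (ball ((i : S) : X) (r i))} = univ := by
      ext i
      simp only [mem_ofPred_eq, mem_univ, iff_true]
      exact (hb _ _ (hr0 _)).1
    rw [huniv] at this
    exact countable_coe_iff.1 (countable_univ_iff.1 this)
  have hScov : S ⊆ ⋃ a ∈ u, ball ((a : S) : X) (2 * (2 * (2 * r a))) := by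
    intro x hx
    obtain ⟨b, hbu, hsub⟩ := hcov ⟨x, hx⟩ (mem_univ _)
    refine mem_biUnion hbu ?_
    have := hsub (mem_closedBall_self (hr0 ⟨x, hx⟩).le)
    rw [mem_closedBall] at this
    rw [mem_ball]
    have := hr0 b
    simp only at *
    linarith
  have : Countable u := hucount.to_subtype
  calc l * μ S ≤ l * ∑' a : u, μ (ball ((a : S) : X) (2 * (2 * (2 * r a)))) := by
        gcongr
        exact (measure_mono hScov).trans (measure_biUnion_le μ hucount _)
    _ ≤ l * ∑' a : u, K ^ 3 * μ (ball ((a : S) : X) (r a)) := by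
        gcongr with a
        have := hr0 a
        calc _ ≤ K * (K * (K * μ (ball ((a : S) : X) (r a)))) := by
              refine (hK _ _ (by linarith)).trans ?_
              gcongr
              refine (hK _ _ (by linarith)).trans ?_
              gcongr
              exact hK _ _ this
          _ = _ := by ring
    _ = K ^ 3 * ∑' a : u, l * μ (ball ((a : S) : X) (r a)) := by
        rw [ENNReal.tsum_mul_left, ENNReal.tsum_mul_left]; ring
    _ ≤ K ^ 3 * ∑' a : u, ∫⁻ y in ball ((a : S) : X) (r a), g y ∂μ := by
        gcongr with a
        exact hr a
    _ = K ^ 3 * ∫⁻ y in ⋃ a ∈ u, ball ((a : S) : X) (r a), g y ∂μ := by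
        rw [lintegral_biUnion hucount (fun _ _ => measurableSet_ball) hd']
    _ ≤ _ := by
        exact mul_le_mul_right (setLIntegral_le_lintegral _ _) _

lemma zpow2 (k : ℤ) : (2 : ℝ≥0∞) ^ k = (2 : ℝ≥0∞) ^ (k : ℝ) := (ENNReal.rpow_intCast _ _).symm

lemma rpow_le_tsum {p : ℝ} (hp : 0 < p) (t : ℝ≥0∞) :
    t ^ p ≤ ∑' k : ℤ, if (2 : ℝ≥0∞) ^ k < t then ((2 : ℝ≥0∞) ^ (k + 1)) ^ p else 0 := by
  rcases eq_or_ne t 0 with rfl | h0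
  · simp [hp]
  rcases eq_or_ne t ∞ with rfl | ht
  · refine le_of_le_of_eq le_top ?_
    symm
    rw [eq_top_iff]
    calc (∞ : ℝ≥0∞) = ∑' _ : ℕ, (1 : ℝ≥0∞) :=
          (ENNReal.tsum_const_eq_top_of_ne_zero one_ne_zero).symm
      _ ≤ ∑' n : ℕ, if (2 : ℝ≥0∞) ^ (n : ℤ) < ∞ then ((2 : ℝ≥0∞) ^ ((n : ℤ) + 1)) ^ p else 0 := by
          gcongr with n
          rw [if_pos (ENNReal.zpow_lt_top (by norm_num) (by norm_num) _)]
          apply ENNReal.one_le_rpow _ hp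
          have : ((n : ℤ) + 1) = ((n + 1 : ℕ) : ℤ) := by push_cast; rfl
          rw [this, zpow_natCast]
          exact one_le_pow₀ (by norm_num)
      _ ≤ _ := ENNReal.tsum_comp_le_tsum_of_injective Nat.cast_injective
          (fun k : ℤ => if (2 : ℝ≥0∞) ^ k < ∞ then ((2 : ℝ≥0∞) ^ (k + 1)) ^ p else 0)
  obtain ⟨k, hk1, hk2⟩ := ENNReal.exists_mem_Ioc_zpow h0 ht (y := 2) (by norm_num) (by norm_num)
  refine le_trans ?_ (ENNReal.le_tsum k)
  rw [if_pos hk1]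
  gcongr

lemma geo_tsum {p : ℝ} (hp : 1 < p) : ∃ C : ℝ≥0∞, C ≠ ∞ ∧ ∀ t : ℝ≥0∞,
    ∑' k : ℤ, (if (2 : ℝ≥0∞) ^ k < 2 * t then ((2 : ℝ≥0∞) ^ (k : ℝ)) ^ (p - 1) * t else 0) ≤
      C * t ^ p := by
  have h21 : ((2 : ℝ≥0∞) ^ (-(p - 1)) : ℝ≥0∞) < 1 :=
    ENNReal.rpow_lt_one_of_one_lt_of_neg (by norm_num) (by linarith)
  refine ⟨2 ^ (p - 1) * (1 - (2 : ℝ≥0∞) ^ (-(p - 1)))⁻¹, ?_, fun t => ?_⟩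
  · apply ENNReal.mul_ne_top
    · exact ENNReal.rpow_ne_top_of_nonneg (by linarith) (by norm_num)
    · rw [Ne, ENNReal.inv_eq_top, tsub_eq_zero_iff_le, not_le]
      exact h21
  rcases eq_or_ne t 0 with rfl | h0
  · simp
  rcases eq_or_ne t ∞ with rfl | ht
  · have hne : (2 : ℝ≥0∞) ^ (p - 1) * (1 - (2 : ℝ≥0∞) ^ (-(p - 1)))⁻¹ ≠ 0 := by
      apply mul_ne_zero
      · simp
      · rw [ENNReal.inv_ne_zero]
        exact (tsub_le_self.trans_lt ENNReal.one_lt_top).ne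
    rw [ENNReal.top_rpow_of_pos (by linarith), ENNReal.mul_top hne]
    exact le_top
  obtain ⟨k1, hk1, hk2⟩ := ENNReal.exists_mem_Ioc_zpow (x := 2 * t) (by simpa using h0)
    (ENNReal.mul_ne_top (by norm_num) ht) (y := 2) (by norm_num) (by norm_num)
  have hinj : Function.Injective fun j : ℕ => k1 - (j : ℤ) := by
    intro a b h
    simpa using h
  rw [← hinj.tsum_eq]
  · calc _ ≤ ∑' j : ℕ, ((2 : ℝ≥0∞) ^ (k1 : ℝ)) ^ (p - 1) * t *
            ((2 : ℝ≥0∞) ^ (-(p - 1))) ^ j := by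
          gcongr with j
          split_ifs
          · apply le_of_eq
            rw [← ENNReal.rpow_natCast, ← ENNReal.rpow_mul, ← ENNReal.rpow_mul,
              ← ENNReal.rpow_mul, mul_right_comm, ← ENNReal.rpow_add _ _ (by norm_num)
                (by norm_num)]
            congr 2
            push_cast
            ring
          · exact zero_le
      _ = ((2 : ℝ≥0∞) ^ (k1 : ℝ)) ^ (p - 1) * t * (1 - (2 : ℝ≥0∞) ^ (-(p - 1)))⁻¹ := by
          rw [ENNReal.tsum_mul_left, ENNReal.tsum_geometric]
      _ ≤ (2 * t) ^ (p - 1) * t * (1 - (2 : ℝ≥0∞) ^ (-(p - 1)))⁻¹ := by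
          have h5 : (2 : ℝ≥0∞) ^ (k1 : ℝ) ≤ 2 * t := by rw [← zpow2]; exact hk1.le
          have h6 := ENNReal.rpow_le_rpow h5 (by linarith : 0 ≤ p - 1)
          gcongr
      _ = _ := by
          rw [ENNReal.mul_rpow_of_nonneg _ _ (by linarith),
            show t ^ p = t ^ (p - 1) * t by
              nth_rewrite 3 [← ENNReal.rpow_one t]
              rw [← ENNReal.rpow_add _ _ h0 ht]; congr 1; ring]
          ring
  · intro k hk
    rw [Function.mem_support] at hk
    have h3 : (2 : ℝ≥0∞) ^ k < 2 * t := by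
      by_contra h
      exact hk (if_neg h)
    have h4 : (2 : ℝ≥0∞) ^ k < 2 ^ (k1 + 1) := h3.trans_le hk2
    have h5 : k < k1 + 1 := by
      by_contra h
      exact absurd h4 (not_lt.2 (ENNReal.zpow_le_of_le (by norm_num) (not_lt.1 h)))
    exact ⟨(k1 - k).toNat, by
      change k1 - ((k1 - k).toNat : ℤ) = k
      omega⟩

lemma strong_type {μ : Measure X} [SFinite μ] (hb : BallsPosFinite μ) {K : ℝ≥0∞}
    (hK : ∀ (x : X) (r : ℝ), 0 < r → μ (ball x (2 * r)) ≤ K * μ (ball x r))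
    {Q c : ℝ} (hQ : 0 < Q) (hc : 0 < c)
    (hlow : ∀ (x : X) (r : ℝ), 0 < r → ENNReal.ofReal (c * r ^ Q) ≤ μ (ball x r))
    (hKt : K ≠ ∞) (hK0 : K ≠ 0) {p : ℝ} (hp : 1 < p) :
    ∃ C : ℝ≥0∞, C ≠ ∞ ∧ ∀ g : X → ℝ≥0∞, Measurable g →
      ∫⁻ x, maxFn μ g x ^ p ∂μ ≤ C * ∫⁻ x, g x ^ p ∂μ := by
  obtain ⟨C, hC, hgeo⟩ := geo_tsum hp
  refine ⟨2 ^ (p + 1) * K ^ 3 * C, ENNReal.mul_ne_top (ENNReal.mul_ne_top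
    (ENNReal.rpow_ne_top_of_nonneg (by linarith) (by norm_num)) (ENNReal.pow_ne_top hKt)) hC,
    fun g hg => ?_⟩
  have h2k0 : ∀ k : ℤ, (2 : ℝ≥0∞) ^ k ≠ 0 := fun k =>
    (ENNReal.zpow_pos (by norm_num) (by norm_num) k).ne'
  have h2kt : ∀ k : ℤ, (2 : ℝ≥0∞) ^ k ≠ ∞ := fun k =>
    (ENNReal.zpow_lt_top (by norm_num) (by norm_num) k).ne
  -- level set estimate
  have hlev : ∀ k : ℤ, μ {x | (2 : ℝ≥0∞) ^ k < maxFn μ g x} ≤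
      2 / 2 ^ k * (K ^ 3 * ∫⁻ y, (if (2 : ℝ≥0∞) ^ k < 2 * g y then g y else 0) ∂μ) := by
    intro k
    set l : ℝ≥0∞ := 2 ^ k with hl
    set g' : X → ℝ≥0∞ := fun y => if l < 2 * g y then g y else 0 with hg'
    have hl2 : l / 2 ≠ 0 := by
      simp [ENNReal.div_eq_zero_iff, h2k0 k, hl]
    have hl2t : l / 2 ≠ ∞ := ENNReal.div_ne_top (h2kt k) (by norm_num)
    have hw := weak_type hb hK hQ hc hlow hKt hK0 g' hl2 hl2t
    have hsub : {x | l < maxFn μ g x} ⊆ {x | l / 2 < maxFn μ g' x} := by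
      intro x hx
      change l < maxFn μ g x at hx
      change l / 2 < maxFn μ g' x
      have hle : maxFn μ g x ≤ maxFn μ g' x + l / 2 := by
        refine iSup₂_le fun r hr => ?_
        rw [ENNReal.div_le_iff (hb x r hr).1.ne' (hb x r hr).2.ne]
        calc ∫⁻ y in ball x r, g y ∂μ ≤ ∫⁻ y in ball x r, (g' y + l / 2) ∂μ := by
              gcongr with y
              simp only [hg']
              split_ifs with h
              · exact le_self_add
              · rw [zero_add, ENNReal.le_div_iff_mul_le (by simp) (by simp), mul_comm]
                exact not_lt.1 h
          _ = ∫⁻ y in ball x r, g' y ∂μ + l / 2 * μ (ball x r) := by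
              rw [lintegral_add_right _ measurable_const, setLIntegral_const]
          _ ≤ _ := by
              rw [add_mul]
              gcongr
              exact le_maxFn hb g' x hr
      by_contra hcon
      rw [not_lt] at hcon
      have : maxFn μ g x ≤ l := hle.trans (by
        calc _ ≤ l / 2 + l / 2 := by gcongr
          _ = l := ENNReal.add_halves l)
      exact absurd hx (not_lt.2 this)
    calc μ {x | l < maxFn μ g x} ≤ μ {x | l / 2 < maxFn μ g' x} := measure_mono hsub
      _ = 2 / l * (l / 2 * μ {x | l / 2 < maxFn μ g' x}) := by
          have h7 : 2 / l = (l / 2)⁻¹ := (ENNReal.inv_div (by simp) (by simp)).symm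
          rw [← mul_assoc, h7, ENNReal.inv_mul_cancel hl2 hl2t, one_mul]
      _ ≤ _ := by gcongr
  calc ∫⁻ x, maxFn μ g x ^ p ∂μ ≤ ∫⁻ x, ∑' k : ℤ, (toMeasurable μ
        {x | (2 : ℝ≥0∞) ^ k < maxFn μ g x}).indicator
          (fun _ => ((2 : ℝ≥0∞) ^ (k + 1)) ^ p) x ∂μ := by
        gcongr with x
        refine (rpow_le_tsum (by linarith) _).trans ?_
        gcongr with k
        split_ifs with h
        · rw [indicator_of_mem]
          exact subset_toMeasurable μ _ h
        · exact zero_le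
    _ = ∑' k : ℤ, ((2 : ℝ≥0∞) ^ (k + 1)) ^ p * μ {x | (2 : ℝ≥0∞) ^ k < maxFn μ g x} := by
        rw [lintegral_tsum fun k =>
          (measurable_const.indicator (measurableSet_toMeasurable _ _)).aemeasurable]
        congr 1
        ext k
        rw [lintegral_indicator_const (measurableSet_toMeasurable _ _), measure_toMeasurable]
    _ ≤ ∑' k : ℤ, ((2 : ℝ≥0∞) ^ (k + 1)) ^ p * (2 / 2 ^ k * (K ^ 3 *
          ∫⁻ y, (if (2 : ℝ≥0∞) ^ k < 2 * g y then g y else 0) ∂μ)) := by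
        gcongr with k
        exact hlev k
    _ = ∑' k : ℤ, ∫⁻ y, 2 ^ (p + 1) * K ^ 3 * (if (2 : ℝ≥0∞) ^ k < 2 * g y then
          ((2 : ℝ≥0∞) ^ (k : ℝ)) ^ (p - 1) * g y else 0) ∂μ := by
        congr 1
        ext k
        have hid : ((2 : ℝ≥0∞) ^ (k + 1)) ^ p * (2 / 2 ^ k) =
            2 ^ (p + 1) * ((2 : ℝ≥0∞) ^ (k : ℝ)) ^ (p - 1) := by
          rw [zpow2, zpow2, div_eq_mul_inv, ← ENNReal.rpow_neg, ← ENNReal.rpow_mul,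
            ← ENNReal.rpow_mul]
          nth_rewrite 2 [← ENNReal.rpow_one 2]
          rw [← ENNReal.rpow_add _ _ (by norm_num) (by norm_num),
            ← ENNReal.rpow_add _ _ (by norm_num) (by norm_num),
            ← ENNReal.rpow_add _ _ (by norm_num) (by norm_num)]
          congr 1
          push_cast
          ring
        rw [← mul_assoc, ← mul_assoc, hid, ← lintegral_const_mul']
        · congr 1
          ext y
          split_ifs
          · ring
          · simp
        · refine ENNReal.mul_ne_top (ENNReal.mul_ne_top
            (ENNReal.rpow_ne_top_of_nonneg (by linarith) (by norm_num)) ?_)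
            (ENNReal.pow_ne_top hKt)
          refine ENNReal.rpow_ne_top_of_nonneg (by linarith) ?_
          rw [← zpow2]; exact h2kt k
    _ = ∫⁻ y, ∑' k : ℤ, 2 ^ (p + 1) * K ^ 3 * (if (2 : ℝ≥0∞) ^ k < 2 * g y then
          ((2 : ℝ≥0∞) ^ (k : ℝ)) ^ (p - 1) * g y else 0) ∂μ := by
        rw [lintegral_tsum]
        intro k
        refine Measurable.aemeasurable (Measurable.const_mul (Measurable.ite ?_ ?_ ?_) _)
        · exact measurableSet_lt measurable_const (hg.const_mul _)
        · exact hg.const_mul _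
        · exact measurable_const
    _ ≤ ∫⁻ y, 2 ^ (p + 1) * K ^ 3 * (C * g y ^ p) ∂μ := by
        gcongr with y
        rw [ENNReal.tsum_mul_left]
        gcongr
        exact hgeo _
    _ = _ := by
        rw [lintegral_const_mul _ ((hg.pow_const _).const_mul _),
          lintegral_const_mul _ (hg.pow_const _)]
        ring
/-- real-valued version of the distance weight -/
def wt (E : Set X) (b : ℝ) (y : X) : ℝ≥0∞ := ENNReal.ofReal (infDist y E ^ b)

/-- Riesz type kernel -/
def ker (μ : Measure X) (b : ℝ) (x y : X) : ℝ≥0∞ :=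
  ENNReal.ofReal (dist x y ^ b) / μ (ball x (dist x y))

lemma measurable_wt (E : Set X) (b : ℝ) : Measurable (wt E b) :=
  ((measurable_infDist (s := E)).pow_const b).ennreal_ofReal

lemma wt_ne_top (E : Set X) (b : ℝ) (y : X) : wt E b y ≠ ∞ := ENNReal.ofReal_ne_top

lemma measurable_ker [SecondCountableTopology X] (μ : Measure X) [SFinite μ] (b : ℝ) :
    Measurable (fun z : X × X => ker μ b z.1 z.2) := by
  unfold ker
  have hd : Measurable fun z : X × X => dist z.1 z.2 := by
    apply Continuous.measurable; fun_prop
  refine Measurable.div (hd.pow_const b).ennreal_ofReal ?_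
  have hs : MeasurableSet {z : (X × X) × X | dist z.2 z.1.1 < dist z.1.1 z.1.2} := by
    apply IsOpen.measurableSet
    apply isOpen_lt <;> fun_prop
  exact measurable_measure_prodMk_left hs

lemma measurable_ker_right [SecondCountableTopology X] (μ : Measure X) [SFinite μ] (b : ℝ)
    (x : X) : Measurable (fun y : X => ker μ b x y) :=
  (measurable_ker μ b).comp measurable_prodMk_left

lemma ker_pow {m : ℝ≥0∞} (hm0 : m ≠ 0) (hmt : m ≠ ∞) {d c Q b θ : ℝ} (hd : 0 < d) (hc : 0 < c)
    (hθ : 1 ≤ θ) (hm : ENNReal.ofReal (c * d ^ Q) ≤ m) :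
    (ENNReal.ofReal (d ^ b) / m) ^ θ ≤
      ENNReal.ofReal (c ^ (-(θ - 1))) * (ENNReal.ofReal (d ^ (b * θ - Q * (θ - 1))) / m) := by
  obtain ⟨m', rfl⟩ : ∃ m' : ℝ, m = ENNReal.ofReal m' := ⟨m.toReal, (ENNReal.ofReal_toReal hmt).symm⟩
  have hm' : 0 < m' := by simpa using hm0
  have hle : c * d ^ Q ≤ m' := (ENNReal.ofReal_le_ofReal_iff hm'.le).1 hm
  have hdp : ∀ z : ℝ, 0 < d ^ z := fun z => Real.rpow_pos_of_pos hd z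
  rw [← ENNReal.ofReal_div_of_pos hm', ← ENNReal.ofReal_div_of_pos hm',
    ← ENNReal.ofReal_mul (by positivity),
    ENNReal.ofReal_rpow_of_nonneg (div_nonneg (hdp _).le hm'.le) (by linarith)]
  apply ENNReal.ofReal_le_ofReal
  have h1 : m' ^ (-(θ - 1)) ≤ (c * d ^ Q) ^ (-(θ - 1)) :=
    Real.rpow_le_rpow_of_nonpos (mul_pos hc (hdp _)) hle (by linarith)
  rw [Real.mul_rpow hc.le (hdp _).le, ← Real.rpow_mul hd.le] at h1
  calc (d ^ b / m') ^ θ = d ^ (b * θ) * m' ^ (-(θ - 1)) / m' := by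
        rw [Real.div_rpow (hdp _).le hm'.le, ← Real.rpow_mul hd.le, Real.rpow_neg hm'.le,
          Real.rpow_sub_one hm'.ne']
        have := Real.rpow_pos_of_pos hm' θ
        field_simp
    _ ≤ d ^ (b * θ) * (c ^ (-(θ - 1)) * d ^ (Q * -(θ - 1))) / m' := by
        have := (hdp (b * θ)).le
        gcongr
    _ = _ := by
        rw [show b * θ - Q * (θ - 1) = b * θ + Q * -(θ - 1) by ring, Real.rpow_add hd]
        ring

lemma ker_split {m : ℝ≥0∞} (hm0 : m ≠ 0) (hmt : m ≠ ∞) {d s A p : ℝ} (hd : 0 < d)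
    (hp : 1 < p) :
    (ENNReal.ofReal (d ^ (-A)) / m) ^ ((p - 1) / p) *
      (ENNReal.ofReal (d ^ (s * p + A * (p - 1))) / m) ^ (1 / p) = ENNReal.ofReal (d ^ s) / m := by
  obtain ⟨m', rfl⟩ : ∃ m' : ℝ, m = ENNReal.ofReal m' := ⟨m.toReal, (ENNReal.ofReal_toReal hmt).symm⟩
  have hm' : 0 < m' := by simpa using hm0
  have hdp : ∀ z : ℝ, 0 < d ^ z := fun z => Real.rpow_pos_of_pos hd z
  have hp0 : p ≠ 0 := by linarith
  rw [← ENNReal.ofReal_div_of_pos hm', ← ENNReal.ofReal_div_of_pos hm',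
    ← ENNReal.ofReal_div_of_pos hm', ENNReal.ofReal_rpow_of_pos (div_pos (hdp _) hm'),
    ENNReal.ofReal_rpow_of_pos (div_pos (hdp _) hm'), ← ENNReal.ofReal_mul (by positivity)]
  congr 1
  rw [Real.div_rpow (hdp _).le hm'.le, Real.div_rpow (hdp _).le hm'.le, ← Real.rpow_mul hd.le,
    ← Real.rpow_mul hd.le, div_mul_div_comm, ← Real.rpow_add hd, ← Real.rpow_add hm']
  congr 1
  · congr 1; field_simp; ring
  · rw [show (p - 1) / p + 1 / p = 1 by field_simp; ring, Real.rpow_one]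

/-- Hölder in the form used below. -/
lemma holder' {ν : Measure X} {p : ℝ} (hp : 1 < p) {u v : X → ℝ≥0∞}
    (hu : AEMeasurable u ν) (hv : AEMeasurable v ν) :
    (∫⁻ y, u y * v y ∂ν) ^ p ≤
      (∫⁻ y, u y ^ (p / (p - 1)) ∂ν) ^ (p - 1) * ∫⁻ y, v y ^ p ∂ν := by
  have hpq := (Real.HolderConjugate.conjExponent hp).symm
  have h := ENNReal.lintegral_mul_le_Lp_mul_Lq ν hpq hu hv
  have hp0 : p ≠ 0 := by linarith
  have hp1 : p - 1 ≠ 0 := by linarith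
  calc _ ≤ ((∫⁻ y, u y ^ (p / (p - 1)) ∂ν) ^ (1 / (p / (p - 1))) *
        (∫⁻ y, v y ^ p ∂ν) ^ (1 / p)) ^ p := ENNReal.rpow_le_rpow h (by linarith)
    _ = _ := by
      rw [ENNReal.mul_rpow_of_nonneg _ _ (by linarith), ← ENNReal.rpow_mul, ← ENNReal.rpow_mul,
        one_div_mul_cancel hp0, ENNReal.rpow_one]
      congr 2
      field_simp

lemma jensen' {ν : Measure X} {r : ℝ} (hr : 1 ≤ r) {φ H : X → ℝ≥0∞}
    (hφ : AEMeasurable φ ν) (hH : AEMeasurable H ν) :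
    (∫⁻ y, φ y * H y ∂ν) ^ r ≤ (∫⁻ y, φ y ∂ν) ^ (r - 1) * ∫⁻ y, φ y * H y ^ r ∂ν := by
  rcases hr.eq_or_lt with rfl | hr
  · simp
  have hr0 : 0 < r := by linarith
  have hr1 : r - 1 ≠ 0 := by linarith
  have h := holder' hr (ν := ν) (u := fun y => φ y ^ ((r - 1) / r))
    (v := fun y => φ y ^ (1 / r) * H y) (hφ.pow_const _) ((hφ.pow_const _).mul hH)
  have e1 : ∀ y, φ y ^ ((r - 1) / r) * (φ y ^ (1 / r) * H y) = φ y * H y := by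
    intro y
    rw [← mul_assoc, ← ENNReal.rpow_add_of_nonneg _ _ (div_nonneg (by linarith) hr0.le)
      (by positivity)]
    rw [show (r - 1) / r + 1 / r = 1 by field_simp; ring, ENNReal.rpow_one]
  have e2 : ∀ y, (φ y ^ ((r - 1) / r)) ^ (r / (r - 1)) = φ y := by
    intro y
    rw [← ENNReal.rpow_mul, show (r - 1) / r * (r / (r - 1)) = 1 by field_simp, ENNReal.rpow_one]
  have e3 : ∀ y, (φ y ^ (1 / r) * H y) ^ r = φ y * H y ^ r := by
    intro y
    rw [ENNReal.mul_rpow_of_nonneg _ _ hr0.le, ← ENNReal.rpow_mul, one_div_mul_cancel hr0.ne',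
      ENNReal.rpow_one]
  simpa only [e1, e2, e3] using h

lemma hedberg_real {P M N A : ℝ≥0∞} {δ s Q p q : ℝ} (hδ : 0 < δ) (hA0 : A ≠ 0)
    (hp : 1 < p) (hpq : p ≤ q) (hQ : 0 < Q) (hs : 0 < s)
    (hκ : 0 ≤ Q + q * s - q * Q / p) (hN : N ≠ ∞)
    (hN0 : N = 0 → P = 0)
    (h1 : ∀ r, 0 < r → P ≤ A * (M * ENNReal.ofReal (r ^ s)) +
      A * (N ^ (1 / p) * ENNReal.ofReal (r ^ (s - Q / p))))
    (h2 : P ≤ A * (M * ENNReal.ofReal (δ ^ s))) :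
    P ^ q * ENNReal.ofReal (δ ^ (-(Q + q * s - q * Q / p))) ≤
      (2 * A) ^ q * (N ^ (q / p - 1) * M ^ p) := by
  have hq : 0 < q := by linarith
  have hp0 : 0 < p := by linarith
  have hqp : 0 ≤ q / p - 1 := by rw [sub_nonneg, le_div_iff₀ hp0]; linarith
  rcases eq_or_ne N 0 with hN' | hN'
  · rw [hN0 hN', ENNReal.zero_rpow_of_pos hq, zero_mul]; exact zero_le
  rcases eq_or_ne M 0 with rfl | hM0
  · have : P = 0 := by simpa using h2
    rw [this, ENNReal.zero_rpow_of_pos hq, zero_mul]; exact zero_le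
  rcases eq_or_ne M ∞ with rfl | hMt
  · rw [ENNReal.top_rpow_of_pos hp0, ENNReal.mul_top, ENNReal.mul_top]
    · exact le_top
    · have : 2 * A ≠ 0 := mul_ne_zero (by norm_num) hA0
      rw [Ne, ENNReal.rpow_eq_zero_iff]
      rintro (⟨h, -⟩ | ⟨-, h⟩)
      · exact this h
      · linarith
    · rw [Ne, ENNReal.rpow_eq_zero_iff]
      rintro (⟨h, -⟩ | ⟨h, -⟩)
      · exact hN' h
      · exact hN h
  obtain ⟨n, rfl⟩ : ∃ n : ℝ, N = ENNReal.ofReal n := ⟨N.toReal, (ENNReal.ofReal_toReal hN).symm⟩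
  obtain ⟨m, rfl⟩ : ∃ m : ℝ, M = ENNReal.ofReal m := ⟨M.toReal, (ENNReal.ofReal_toReal hMt).symm⟩
  have hn : 0 < n := by simpa using hN'
  have hm : 0 < m := by simpa using hM0
  set r0 : ℝ := (n ^ (1 / p) / m) ^ (p / Q) with hr0
  have hnp : 0 < n ^ (1 / p) := Real.rpow_pos_of_pos hn _
  have hr0p : 0 < r0 := by positivity
  have hr0Q : r0 ^ (Q / p) = n ^ (1 / p) / m := by
    rw [hr0, ← Real.rpow_mul (by positivity), show p / Q * (Q / p) = 1 by field_simp,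
      Real.rpow_one]
  obtain ⟨r, hr, hrδ, hrr0, hP⟩ : ∃ r, 0 < r ∧ r ≤ δ ∧ r ≤ r0 ∧
      P ≤ 2 * A * ENNReal.ofReal (m * r ^ s) := by
    rcases le_total δ r0 with h | h
    · refine ⟨δ, hδ, le_rfl, h, h2.trans ?_⟩
      rw [ENNReal.ofReal_mul hm.le]
      gcongr
      calc A = 1 * A := (one_mul _).symm
        _ ≤ 2 * A := by gcongr; norm_num
    · refine ⟨r0, hr0p, h, le_rfl, (h1 r0 hr0p).trans (le_of_eq ?_)⟩
      rw [ENNReal.ofReal_rpow_of_pos hn, ← ENNReal.ofReal_mul hm.le, ← ENNReal.ofReal_mul hnp.le]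
      have : n ^ (1 / p) * r0 ^ (s - Q / p) = m * r0 ^ s := by
        rw [Real.rpow_sub hr0p, hr0Q]
        field_simp
      rw [this]
      ring
  have hreal : (m * r ^ s) ^ q * δ ^ (-(Q + q * s - q * Q / p)) ≤ n ^ (q / p - 1) * m ^ p := by
    calc _ ≤ (m * r ^ s) ^ q * r ^ (-(Q + q * s - q * Q / p)) := by
          have : 0 ≤ (m * r ^ s) ^ q := by positivity
          exact mul_le_mul_of_nonneg_left (Real.rpow_le_rpow_of_nonpos hr hrδ (by linarith)) this
      _ = m ^ q * r ^ (Q / p * (q - p)) := by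
          rw [Real.mul_rpow hm.le (by positivity), mul_assoc, ← Real.rpow_mul hr.le,
            ← Real.rpow_add hr]
          congr 2
          field_simp
          ring
      _ ≤ m ^ q * r0 ^ (Q / p * (q - p)) := by
          have h5 : 0 ≤ Q / p * (q - p) := mul_nonneg (by positivity) (by linarith)
          exact mul_le_mul_of_nonneg_left (Real.rpow_le_rpow hr.le hrr0 h5) (by positivity)
      _ = n ^ (q / p - 1) * m ^ p := by
          rw [Real.rpow_mul hr0p.le, hr0Q, Real.div_rpow hnp.le hm.le, ← Real.rpow_mul hn.le,
            show m ^ q = m ^ p * m ^ (q - p) by rw [← Real.rpow_add hm]; congr 1; ring,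
            show 1 / p * (q - p) = q / p - 1 by field_simp]
          have := Real.rpow_pos_of_pos hm (q - p)
          field_simp
  calc _ ≤ (2 * A * ENNReal.ofReal (m * r ^ s)) ^ q *
        ENNReal.ofReal (δ ^ (-(Q + q * s - q * Q / p))) := by
        gcongr
    _ = (2 * A) ^ q * ENNReal.ofReal ((m * r ^ s) ^ q * δ ^ (-(Q + q * s - q * Q / p))) := by
        rw [ENNReal.mul_rpow_of_nonneg _ _ hq.le, ENNReal.ofReal_rpow_of_nonneg (by positivity)
          hq.le, ENNReal.ofReal_mul (by positivity), mul_assoc]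
    _ ≤ (2 * A) ^ q * ENNReal.ofReal (n ^ (q / p - 1) * m ^ p) := by gcongr
    _ = _ := by
        rw [ENNReal.ofReal_rpow_of_pos hn, ENNReal.ofReal_rpow_of_pos hm,
          ENNReal.ofReal_mul (by positivity)]

/-- far part by Hölder -/
lemma ker_far {μ : Measure X} [SecondCountableTopology X] [SFinite μ] (hb : BallsPosFinite μ)
    {K : ℝ≥0∞} (hKt : K ≠ ∞)
    (hK : ∀ (x : X) (r : ℝ), 0 < r → μ (ball x (2 * r)) ≤ K * μ (ball x r))
    {Q c : ℝ} (hc : 0 < c)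
    (hlow : ∀ (x : X) (r : ℝ), 0 < r → ENNReal.ofReal (c * r ^ Q) ≤ μ (ball x r))
    {s p : ℝ} (hp : 1 < p) (hsp : s * p < Q) :
    ∃ A : ℝ≥0∞, A ≠ ∞ ∧ ∀ g : X → ℝ≥0∞, Measurable g → ∀ (x : X) (r : ℝ), 0 < r →
      ∫⁻ y in {y | r ≤ dist x y}, ker μ s x y * g y ∂μ ≤
        A * ((∫⁻ y, g y ^ p ∂μ) ^ (1 / p) * ENNReal.ofReal (r ^ (s - Q / p))) := by
  have hp0 : p ≠ 0 := by linarith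
  have hp0' : 0 < p := by linarith
  have hp1 : 0 < p - 1 := by linarith
  set θ := p / (p - 1) with hθ
  have hθ1 : 1 ≤ θ := by rw [hθ, le_div_iff₀ hp1]; linarith
  set e := s * θ - Q * (θ - 1) with he
  have he2 : e = θ * (s - Q / p) := by
    rw [he, hθ]; field_simp; ring
  have hneg : s - Q / p < 0 := by
    rw [sub_neg, lt_div_iff₀ hp0']; exact hsp
  have he0 : e < 0 := by
    rw [he2]; exact mul_neg_of_pos_of_neg (by linarith) hneg
  set B : ℝ≥0∞ := ENNReal.ofReal (c ^ (-(θ - 1))) * ((ENNReal.ofReal (2 ^ |e| * 4 ^ (-(0:ℝ))) *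
    K ^ 2 * 1) * (1 - ENNReal.ofReal ((2 : ℝ) ^ (e - 0)))⁻¹) with hB
  have hBt : B ≠ ∞ := by
    refine ENNReal.mul_ne_top ENNReal.ofReal_ne_top (ENNReal.mul_ne_top (ENNReal.mul_ne_top
      (ENNReal.mul_ne_top ENNReal.ofReal_ne_top (ENNReal.pow_ne_top hKt)) (by norm_num))
      (geom_const_ne_top (by linarith)))
  refine ⟨B ^ (1 / θ), ENNReal.rpow_ne_top_of_nonneg (by positivity) hBt, ?_⟩
  intro g hg x r hr
  have hS : MeasurableSet {y : X | r ≤ dist x y} := by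
    apply IsClosed.measurableSet
    exact isClosed_le continuous_const (by fun_prop)
  have hH := ENNReal.lintegral_mul_le_Lp_mul_Lq (μ.restrict {y | r ≤ dist x y})
    (Real.HolderConjugate.conjExponent hp).symm
    (measurable_ker_right μ s x).aemeasurable hg.aemeasurable
  change _ ≤ (∫⁻ y in {y | r ≤ dist x y}, ker μ s x y ^ θ ∂μ) ^ (1 / θ) * _ at hH
  have h1 : ∫⁻ y in {y | r ≤ dist x y}, ker μ s x y ^ θ ∂μ ≤ B * ENNReal.ofReal (r ^ e) := by
    calc _ ≤ ∫⁻ y in {y | r ≤ dist x y}, ENNReal.ofReal (c ^ (-(θ - 1))) *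
          (ENNReal.ofReal (dist x y ^ e) / μ (ball x (dist x y)) * 1) ∂μ := by
          refine setLIntegral_mono' hS fun y hy => ?_
          have hd : 0 < dist x y := lt_of_lt_of_le hr hy
          rw [mul_one]
          exact ker_pow (hb x _ hd).1.ne' (hb x _ hd).2.ne hd hc hθ1 (hlow x _ hd)
      _ = ENNReal.ofReal (c ^ (-(θ - 1))) * ∫⁻ y in {y | r ≤ dist x y},
          ENNReal.ofReal (dist x y ^ e) / μ (ball x (dist x y)) * 1 ∂μ :=
          lintegral_const_mul' _ _ ENNReal.ofReal_ne_top
      _ ≤ ENNReal.ofReal (c ^ (-(θ - 1))) * ((ENNReal.ofReal (2 ^ |e| * 4 ^ (-(0:ℝ))) *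
            K ^ 2 * 1) * (1 - ENNReal.ofReal ((2 : ℝ) ^ (e - 0)))⁻¹ *
            ENNReal.ofReal (r ^ (e - 0))) := by
          gcongr
          exact far_bound hb hK (fun _ => 1) x e 0 1 hr (fun t _ => by simp)
      _ = _ := by rw [hB, sub_zero]; ring
  calc _ ≤ _ := hH
    _ ≤ (B * ENNReal.ofReal (r ^ e)) ^ (1 / θ) * (∫⁻ y, g y ^ p ∂μ) ^ (1 / p) := by
        have h3 : ∫⁻ y in {y | r ≤ dist x y}, g y ^ p ∂μ ≤ ∫⁻ y, g y ^ p ∂μ :=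
          setLIntegral_le_lintegral _ _
        gcongr
    _ = _ := by
        rw [ENNReal.mul_rpow_of_nonneg _ _ (by positivity),
          ENNReal.ofReal_rpow_of_pos (Real.rpow_pos_of_pos hr _), ← Real.rpow_mul hr.le, he2,
          show θ * (s - Q / p) * (1 / θ) = s - Q / p by field_simp]
        ring

lemma wt_mul {E : Set X} {y : X} (hy : 0 < infDist y E) (b b' : ℝ) :
    wt E b y * wt E b' y = wt E (b + b') y := by
  unfold wt
  rw [← ENNReal.ofReal_mul (by positivity), Real.rpow_add hy]

lemma wt_pow {E : Set X} {y : X} (hy : 0 < infDist y E) (b θ : ℝ) :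
    wt E b y ^ θ = wt E (b * θ) y := by
  unfold wt
  rw [ENNReal.ofReal_rpow_of_pos (Real.rpow_pos_of_pos hy _), ← Real.rpow_mul hy.le]

lemma wt_zero {E : Set X} (y : X) : wt E 0 y = 1 := by
  simp [wt]

/-- pointwise Hölder estimate for the nonlocal part -/
lemma nonlocal_pointwise {μ : Measure X} [SecondCountableTopology X] [SFinite μ]
    (hb : BallsPosFinite μ) {K : ℝ≥0∞} (hKt : K ≠ ∞)
    (hK : ∀ (x : X) (r : ℝ), 0 < r → μ (ball x (2 * r)) ≤ K * μ (ball x r))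
    {E : Set X} (hE : E.Nonempty) (hE0 : ∀ᵐ y ∂μ, 0 < infDist y E) {ρ : ℝ} (A : ℝ)
    (hρ : ∀ x ∈ E, ∀ r R : ℝ, 0 < r → r < R →
      μ ({y : X | infDist y E < r} ∩ ball x R) ≤
      ENNReal.ofReal (A * (r / R) ^ ρ) * μ (ball x R)) (hA : 0 ≤ A)
    {α ε s p : ℝ} (hα : α < ρ) (hε : 0 < ε) (hp : 1 < p) :
    ∃ C : ℝ≥0∞, C ≠ ∞ ∧ ∀ f : X → ℝ≥0∞, Measurable f → ∀ x : X, 0 < infDist x E →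
      (∫⁻ y in {y | infDist x E / 2 ≤ dist x y}, ker μ s x y * f y ∂μ) ^ p ≤
        C * wt E (-ε * (p - 1)) x * ∫⁻ y in {y | infDist x E / 2 ≤ dist x y},
          f y ^ p * wt E (α * (p - 1)) y * ker μ (s * p + (ε - α) * (p - 1)) x y ∂μ := by
  obtain ⟨N, hNt, hN⟩ := aikawa hb hKt hK hE hE0 A hρ hA hα
  have hp0 : 0 < p := by linarith
  have hp1 : 0 < p - 1 := by linarith
  set B : ℝ≥0∞ := (ENNReal.ofReal (2 ^ |α - ε| * 4 ^ (-α)) * K ^ 2 * N) *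
        (1 - ENNReal.ofReal ((2 : ℝ) ^ (α - ε - α)))⁻¹ * ENNReal.ofReal ((1 / 2) ^ (-ε)) with hB
  have hBt : B ≠ ∞ := by
    refine ENNReal.mul_ne_top (ENNReal.mul_ne_top (ENNReal.mul_ne_top (ENNReal.mul_ne_top
      ENNReal.ofReal_ne_top (ENNReal.pow_ne_top hKt)) hNt) (geom_const_ne_top (by linarith)))
      ENNReal.ofReal_ne_top
  refine ⟨B ^ (p - 1), ENNReal.rpow_ne_top_of_nonneg hp1.le hBt, ?_⟩
  intro f hf x hx
  have hS : MeasurableSet {y : X | infDist x E / 2 ≤ dist x y} := by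
    apply IsClosed.measurableSet
    exact isClosed_le continuous_const (by fun_prop)
  have hfar := far_bound hb hK (wt E (-α)) x (α - ε) α N (t0 := infDist x E / 2) (by positivity)
    (fun t ht => hN x t (by linarith) (by linarith))
  set S := {y : X | infDist x E / 2 ≤ dist x y} with hSdef
  set u : X → ℝ≥0∞ := fun y => (ker μ (-(ε - α)) x y * wt E (-α) y) ^ ((p - 1) / p) with hu
  set v : X → ℝ≥0∞ := fun y => f y * wt E (α * (p - 1) / p) y *
    ker μ (s * p + (ε - α) * (p - 1)) x y ^ (1 / p) with hv
  have hmu : Measurable u :=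
    ((measurable_ker_right μ _ x).mul (measurable_wt E _)).pow_const _
  have hmv : Measurable v :=
    (hf.mul (measurable_wt E _)).mul ((measurable_ker_right μ _ x).pow_const _)
  have hpq1 : 0 ≤ (p - 1) / p := by positivity
  have h1 : ∫⁻ y in S, ker μ s x y * f y ∂μ = ∫⁻ y in S, u y * v y ∂μ := by
    refine setLIntegral_congr_fun_ae hS ?_
    filter_upwards [hE0] with y hy hyS
    have hd : 0 < dist x y := lt_of_lt_of_le (by positivity) hyS
    have hk := ker_split (s := s) (A := ε - α) (hb x _ hd).1.ne' (hb x _ hd).2.ne hd hp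
    have hw : wt E (-α) y ^ ((p - 1) / p) * wt E (α * (p - 1) / p) y = 1 := by
      rw [wt_pow hy, wt_mul hy, ← wt_zero (E := E) y]
      congr 1
      ring
    calc ker μ s x y * f y = (ker μ (-(ε - α)) x y ^ ((p - 1) / p) *
          ker μ (s * p + (ε - α) * (p - 1)) x y ^ (1 / p)) * f y *
          (wt E (-α) y ^ ((p - 1) / p) * wt E (α * (p - 1) / p) y) := by
            rw [hw, mul_one]; unfold ker; rw [hk]
      _ = u y * v y := by
            rw [hu, hv]
            simp only
            rw [ENNReal.mul_rpow_of_nonneg _ _ hpq1]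
            ring
  have h2 : ∀ y, u y ^ (p / (p - 1)) = ker μ (-(ε - α)) x y * wt E (-α) y := by
    intro y
    rw [hu]
    simp only
    rw [← ENNReal.rpow_mul, show (p - 1) / p * (p / (p - 1)) = 1 by field_simp, ENNReal.rpow_one]
  have h3 : ∫⁻ y in S, v y ^ p ∂μ = ∫⁻ y in S, f y ^ p * wt E (α * (p - 1)) y *
      ker μ (s * p + (ε - α) * (p - 1)) x y ∂μ := by
    refine setLIntegral_congr_fun_ae hS ?_
    filter_upwards [hE0] with y hy hyS
    rw [hv]
    simp only
    rw [ENNReal.mul_rpow_of_nonneg _ _ hp0.le, ENNReal.mul_rpow_of_nonneg _ _ hp0.le,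
      ← ENNReal.rpow_mul, one_div_mul_cancel hp0.ne', ENNReal.rpow_one, wt_pow hy,
      div_mul_cancel₀ _ hp0.ne']
  have h4 : ∫⁻ y in S, u y ^ (p / (p - 1)) ∂μ ≤ B * wt E (-ε) x := by
    simp only [h2]
    rw [show -(ε - α) = α - ε by ring]
    refine hfar.trans (le_of_eq ?_)
    rw [hB, wt, show α - ε - α = -ε by ring, mul_assoc _ (ENNReal.ofReal ((1 / 2) ^ (-ε))),
      ← ENNReal.ofReal_mul (by positivity), ← Real.mul_rpow (by norm_num) hx.le,
      show 1 / 2 * infDist x E = infDist x E / 2 by ring]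
  rw [h1]
  refine (holder' hp hmu.aemeasurable hmv.aemeasurable).trans ?_
  rw [h3]
  gcongr
  refine (ENNReal.rpow_le_rpow h4 hp1.le).trans (le_of_eq ?_)
  rw [ENNReal.mul_rpow_of_nonneg _ _ hp1.le, wt_pow hx]

/-- dual kernel estimate -/
lemma nonlocal_dual {μ : Measure X} [SecondCountableTopology X] [SFinite μ]
    (hb : BallsPosFinite μ) {K : ℝ≥0∞} (hKt : K ≠ ∞)
    (hK : ∀ (x : X) (r : ℝ), 0 < r → μ (ball x (2 * r)) ≤ K * μ (ball x r))
    {Q c : ℝ} (hc : 0 < c)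
    (hlow : ∀ (x : X) (r : ℝ), 0 < r → ENNReal.ofReal (c * r ^ Q) ≤ μ (ball x r))
    {E : Set X} (hE : E.Nonempty) (hE0 : ∀ᵐ y ∂μ, 0 < infDist y E) {ρ : ℝ} (A : ℝ)
    (hρ : ∀ x ∈ E, ∀ r R : ℝ, 0 < r → r < R →
      μ ({y : X | infDist y E < r} ∩ ball x R) ≤
      ENNReal.ofReal (A * (r / R) ^ ρ) * μ (ball x R)) (hA : 0 ≤ A)
    {α b r : ℝ} (hα : α < ρ) (hr : 1 ≤ r) (hneg : b * r - Q * (r - 1) - α < 0) :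
    ∃ C : ℝ≥0∞, C ≠ ∞ ∧ ∀ y : X, 0 < infDist y E →
      ∫⁻ x in {x | infDist x E / 2 ≤ dist x y}, ker μ b x y ^ r * wt E (-α) x ∂μ ≤
        C * wt E (b * r - Q * (r - 1) - α) y := by
  obtain ⟨N, hNt, hN⟩ := aikawa hb hKt hK hE hE0 A hρ hA hα
  set e := b * r - Q * (r - 1) with he
  set B : ℝ≥0∞ := (ENNReal.ofReal (2 ^ |e| * 4 ^ (-α)) * K ^ 2 * N) *
        (1 - ENNReal.ofReal ((2 : ℝ) ^ (e - α)))⁻¹ * ENNReal.ofReal ((1 / 3) ^ (e - α)) with hB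
  have hBt : B ≠ ∞ := by
    refine ENNReal.mul_ne_top (ENNReal.mul_ne_top (ENNReal.mul_ne_top (ENNReal.mul_ne_top
      ENNReal.ofReal_ne_top (ENNReal.pow_ne_top hKt)) hNt) (geom_const_ne_top hneg))
      ENNReal.ofReal_ne_top
  set D : ℝ≥0∞ := ENNReal.ofReal (c ^ (-(r - 1))) * K with hD
  have hDt : D ≠ ∞ := ENNReal.mul_ne_top ENNReal.ofReal_ne_top hKt
  refine ⟨D * B, ENNReal.mul_ne_top hDt hBt, ?_⟩
  intro y hy
  have hfar := far_bound hb hK (wt E (-α)) y e α N (t0 := infDist y E / 3) (by positivity)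
    (fun t ht => hN y t (by linarith) (by linarith))
  have hS : MeasurableSet {x : X | infDist y E / 3 ≤ dist y x} := by
    apply IsClosed.measurableSet
    exact isClosed_le continuous_const (by fun_prop)
  calc _ ≤ ∫⁻ x in {x | infDist y E / 3 ≤ dist y x}, ker μ b x y ^ r * wt E (-α) x ∂μ := by
        refine lintegral_mono_set fun x hx => ?_
        simp only [mem_setOf_eq] at hx ⊢
        have := infDist_le_infDist_add_dist (s := E) (x := y) (y := x)
        rw [dist_comm y x] at this ⊢
        linarith
    _ ≤ ∫⁻ x in {x | infDist y E / 3 ≤ dist y x}, D *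
          (ENNReal.ofReal (dist y x ^ e) / μ (ball y (dist y x)) * wt E (-α) x) ∂μ := by
        refine setLIntegral_mono' hS fun x hx => ?_
        have hd : 0 < dist y x := lt_of_lt_of_le (by positivity) hx
        have hd' : 0 < dist x y := by rwa [dist_comm]
        rw [← mul_assoc]
        gcongr
        have h1 := ker_pow (b := b) (hb x _ hd').1.ne' (hb x _ hd').2.ne hd' hc hr (hlow x _ hd')
        refine h1.trans ?_
        rw [hD, mul_assoc, ← he, dist_comm x y]
        gcongr
        have h2 : μ (ball y (dist y x)) ≤ K * μ (ball x (dist y x)) := by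
          refine le_trans (measure_mono ?_) (hK x _ hd)
          intro z hz
          rw [mem_ball] at hz ⊢
          have := dist_triangle z y x
          linarith
        rw [ENNReal.div_le_iff (hb x _ hd).1.ne' (hb x _ hd).2.ne]
        calc ENNReal.ofReal (dist y x ^ e) = ENNReal.ofReal (dist y x ^ e) /
              μ (ball y (dist y x)) * μ (ball y (dist y x)) :=
              (ENNReal.div_mul_cancel (hb y _ hd).1.ne' (hb y _ hd).2.ne).symm
          _ ≤ ENNReal.ofReal (dist y x ^ e) / μ (ball y (dist y x)) *
              (K * μ (ball x (dist y x))) := by gcongr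
          _ = _ := by ring
    _ = D * ∫⁻ x in {x | infDist y E / 3 ≤ dist y x},
          ENNReal.ofReal (dist y x ^ e) / μ (ball y (dist y x)) * wt E (-α) x ∂μ :=
        lintegral_const_mul' _ _ hDt
    _ ≤ D * (B * wt E (e - α) y) := by
        gcongr
        refine hfar.trans (le_of_eq ?_)
        rw [hB, wt, mul_assoc _ (ENNReal.ofReal ((1 / 3) ^ (e - α))),
          ← ENNReal.ofReal_mul (by positivity), ← Real.mul_rpow (by norm_num) hy.le,
          show 1 / 3 * infDist y E = infDist y E / 3 by ring]
    _ = _ := (mul_assoc _ _ _).symm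

lemma nonlocal_part {μ : Measure X} [SecondCountableTopology X] [SFinite μ]
    (hb : BallsPosFinite μ) {K : ℝ≥0∞} (hKt : K ≠ ∞)
    (hK : ∀ (x : X) (r : ℝ), 0 < r → μ (ball x (2 * r)) ≤ K * μ (ball x r))
    {Q c : ℝ} (hc : 0 < c)
    (hlow : ∀ (x : X) (r : ℝ), 0 < r → ENNReal.ofReal (c * r ^ Q) ≤ μ (ball x r))
    {E : Set X} (hE : E.Nonempty) (hE0 : ∀ᵐ y ∂μ, 0 < infDist y E) {ρ : ℝ} (A : ℝ)
    (hρ : ∀ x ∈ E, ∀ r R : ℝ, 0 < r → r < R →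
      μ ({y : X | infDist y E < r} ∩ ball x R) ≤
      ENNReal.ofReal (A * (r / R) ^ ρ) * μ (ball x R)) (hA : 0 ≤ A)
    {s p q β : ℝ} (hp : 1 < p) (hpq : p ≤ q)
    (h1 : Q - q / p * (Q - s * p + β) < ρ) (h2 : β / (p - 1) < ρ) :
    ∃ C : ℝ≥0∞, C ≠ ∞ ∧ ∀ f : X → ℝ≥0∞, Measurable f → ∫⁻ x, f x ^ p * wt E β x ∂μ ≠ ∞ →
      ∫⁻ x, (∫⁻ y in {y | infDist x E / 2 ≤ dist x y}, ker μ s x y * f y ∂μ) ^ q *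
        wt E (q / p * (Q - s * p + β) - Q) x ∂μ ≤
        C * (∫⁻ x, f x ^ p * wt E β x ∂μ) ^ (q / p) := by
  have hp0 : 0 < p := by linarith
  have hp1 : 0 < p - 1 := by linarith
  set r := q / p with hr
  have hr1 : 1 ≤ r := by rw [hr, le_div_iff₀ hp0]; linarith
  have hr0 : 0 < r := by linarith
  have hq : q = p * r := by rw [hr]; field_simp
  set a := r * (Q - s * p + β) - Q with ha
  set α := (β / (p - 1) + ρ) / 2 with hα
  set ε := (ρ + a) / (2 * (p - 1) * r) with hε
  have hε0 : 0 < ε := div_pos (by linarith) (by positivity)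
  have hαρ : α < ρ := by linarith
  have hαβ : β < α * (p - 1) := by
    rw [← div_lt_iff₀ hp1]; linarith
  have hεr : ε * (p - 1) * r = (ρ + a) / 2 := by rw [hε]; field_simp
  set α' := ε * (p - 1) * r - a with hα'
  have hα'ρ : α' < ρ := by linarith
  set b := s * p + (ε - α) * (p - 1) with hbdef
  have hexp : b * r - Q * (r - 1) - α' = (β - α * (p - 1)) * r := by
    rw [hbdef, hα', ha]; ring
  obtain ⟨C1, hC1, H1⟩ := nonlocal_pointwise (s := s) hb hKt hK hE hE0 A hρ hA hαρ hε0 hp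
  obtain ⟨C2, hC2, H2⟩ := nonlocal_dual (b := b) hb hKt hK hc hlow hE hE0 A hρ hA hα'ρ hr1
    (by rw [hexp]; exact mul_neg_of_neg_of_pos (by linarith) hr0)
  refine ⟨C1 ^ r * C2, ENNReal.mul_ne_top (ENNReal.rpow_ne_top_of_nonneg hr0.le hC1) hC2, ?_⟩
  intro f hf hNt
  set N := ∫⁻ x, f x ^ p * wt E β x ∂μ with hN
  have hφ : Measurable fun y => f y ^ p * wt E β y := (hf.pow_const _).mul (measurable_wt E _)
  set φ : X → ℝ≥0∞ := fun y => f y ^ p * wt E β y with hφdef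
  set T : Set (X × X) := {z | infDist z.1 E / 2 ≤ dist z.1 z.2} with hT
  have hTm : MeasurableSet T := by
    apply IsClosed.measurableSet
    have : Continuous fun z : X × X => infDist z.1 E :=
      (continuous_infDist_pt E).comp continuous_fst
    exact isClosed_le (by fun_prop) (by fun_prop)
  set F : X → X → ℝ≥0∞ := fun x y => T.indicator
    (fun z => φ z.2 * (wt E (α * (p - 1) - β) z.2 ^ r * (ker μ b z.1 z.2 ^ r * wt E (-α') z.1)))
    (x, y) with hF
  have hFm : Measurable (Function.uncurry F) := by
    refine Measurable.indicator ?_ hTm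
    refine (hφ.comp measurable_snd).mul ((((measurable_wt E _).comp measurable_snd).pow_const _).mul
      (((measurable_ker μ b).pow_const _).mul ((measurable_wt E _).comp measurable_fst)))
  have hSx : ∀ x, MeasurableSet {y : X | infDist x E / 2 ≤ dist x y} := fun x =>
    measurable_prodMk_left hTm
  have hSy : ∀ y, MeasurableSet {x : X | infDist x E / 2 ≤ dist x y} := fun y =>
    measurable_prodMk_right hTm
  -- pointwise bound in x
  have hpt : ∀ x, 0 < infDist x E →
      (∫⁻ y in {y | infDist x E / 2 ≤ dist x y}, ker μ s x y * f y ∂μ) ^ q * wt E a x ≤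
      C1 ^ r * N ^ (r - 1) * ∫⁻ y, F x y ∂μ := by
    intro x hx
    have hHm : Measurable fun y => wt E (α * (p - 1) - β) y * ker μ b x y :=
      (measurable_wt E _).mul (measurable_ker_right μ b x)
    have e1 : ∫⁻ y in {y | infDist x E / 2 ≤ dist x y},
          f y ^ p * wt E (α * (p - 1)) y * ker μ b x y ∂μ =
        ∫⁻ y in {y | infDist x E / 2 ≤ dist x y}, φ y *
          (wt E (α * (p - 1) - β) y * ker μ b x y) ∂μ := by
      refine setLIntegral_congr_fun_ae (hSx x) ?_
      filter_upwards [hE0] with y hy _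
      rw [hφdef]
      simp only
      rw [show α * (p - 1) = β + (α * (p - 1) - β) by ring, ← wt_mul hy,
        show β + (α * (p - 1) - β) - β = α * (p - 1) - β by ring]
      ring
    have e2 := jensen' (ν := μ.restrict {y | infDist x E / 2 ≤ dist x y}) hr1
      hφ.aemeasurable hHm.aemeasurable
    have e3 : ∫⁻ y in {y | infDist x E / 2 ≤ dist x y}, φ y ∂μ ≤ N :=
      setLIntegral_le_lintegral _ _
    have e4 : (∫⁻ y in {y | infDist x E / 2 ≤ dist x y}, φ y *
          (wt E (α * (p - 1) - β) y * ker μ b x y) ^ r ∂μ) * wt E (-α') x = ∫⁻ y, F x y ∂μ := by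
      rw [← lintegral_mul_const' _ _ (wt_ne_top E _ x), ← lintegral_indicator (hSx x)]
      refine lintegral_congr fun y => ?_
      simp only [hF]
      by_cases hxy : infDist x E / 2 ≤ dist x y
      · rw [indicator_of_mem (by exact hxy), indicator_of_mem (by exact hxy),
          ENNReal.mul_rpow_of_nonneg _ _ hr0.le]
        ring
      · rw [indicator_of_notMem (by exact hxy), indicator_of_notMem (by exact hxy)]
    calc _ = ((∫⁻ y in {y | infDist x E / 2 ≤ dist x y}, ker μ s x y * f y ∂μ) ^ p) ^ r *
          wt E a x := by rw [← ENNReal.rpow_mul, hq]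
      _ ≤ (C1 * wt E (-ε * (p - 1)) x * ∫⁻ y in {y | infDist x E / 2 ≤ dist x y}, φ y *
          (wt E (α * (p - 1) - β) y * ker μ b x y) ∂μ) ^ r * wt E a x := by
          gcongr
          rw [← e1]
          exact H1 f hf x hx
      _ = C1 ^ r * (∫⁻ y in {y | infDist x E / 2 ≤ dist x y}, φ y *
          (wt E (α * (p - 1) - β) y * ker μ b x y) ∂μ) ^ r *
            (wt E (-ε * (p - 1) * r) x * wt E a x) := by
          rw [ENNReal.mul_rpow_of_nonneg _ _ hr0.le, ENNReal.mul_rpow_of_nonneg _ _ hr0.le,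
            wt_pow hx]
          ring
      _ = C1 ^ r * (∫⁻ y in {y | infDist x E / 2 ≤ dist x y}, φ y *
          (wt E (α * (p - 1) - β) y * ker μ b x y) ∂μ) ^ r * wt E (-α') x := by
          rw [wt_mul hx, show -ε * (p - 1) * r + a = -α' by rw [hα']; ring]
      _ ≤ C1 ^ r * (N ^ (r - 1) * ∫⁻ y in {y | infDist x E / 2 ≤ dist x y}, φ y *
          (wt E (α * (p - 1) - β) y * ker μ b x y) ^ r ∂μ) * wt E (-α') x := by
          have : 0 ≤ r - 1 := by linarith
          gcongr
          exact e2.trans (by gcongr)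
      _ = _ := by rw [← e4]; ring
  -- inner integral bound
  have hin : ∀ y, 0 < infDist y E → ∫⁻ x, F x y ∂μ ≤ C2 * φ y := by
    intro y hy
    calc ∫⁻ x, F x y ∂μ = ∫⁻ x in {x | infDist x E / 2 ≤ dist x y},
          φ y * (wt E (α * (p - 1) - β) y ^ r * (ker μ b x y ^ r * wt E (-α') x)) ∂μ := by
          rw [← lintegral_indicator (hSy y)]
          refine lintegral_congr fun x => ?_
          simp only [hF]
          by_cases hxy : infDist x E / 2 ≤ dist x y
          · rw [indicator_of_mem (by exact hxy), indicator_of_mem (by exact hxy)]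
          · rw [indicator_of_notMem (by exact hxy), indicator_of_notMem (by exact hxy)]
      _ = φ y * (wt E (α * (p - 1) - β) y ^ r * ∫⁻ x in {x | infDist x E / 2 ≤ dist x y},
            ker μ b x y ^ r * wt E (-α') x ∂μ) := by
          have hkm : Measurable fun x => ker μ b x y ^ r * wt E (-α') x :=
            (((measurable_ker μ b).comp measurable_prodMk_right).pow_const _).mul
              (measurable_wt E _)
          rw [lintegral_const_mul _ (hkm.const_mul _), lintegral_const_mul _ hkm]
      _ ≤ φ y * (wt E (α * (p - 1) - β) y ^ r * (C2 * wt E (b * r - Q * (r - 1) - α') y)) := by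
          gcongr
          exact H2 y hy
      _ = C2 * φ y * (wt E ((α * (p - 1) - β) * r) y * wt E ((β - α * (p - 1)) * r) y) := by
          rw [wt_pow hy, hexp]; ring
      _ = C2 * φ y := by
          rw [wt_mul hy, show (α * (p - 1) - β) * r + (β - α * (p - 1)) * r = 0 by ring, wt_zero,
            mul_one]
  have hc1 : C1 ^ r * N ^ (r - 1) ≠ ∞ :=
    ENNReal.mul_ne_top (ENNReal.rpow_ne_top_of_nonneg hr0.le hC1)
      (ENNReal.rpow_ne_top_of_nonneg (by linarith) hNt)
  calc _ ≤ ∫⁻ x, C1 ^ r * N ^ (r - 1) * ∫⁻ y, F x y ∂μ ∂μ := by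
        refine lintegral_mono_ae ?_
        filter_upwards [hE0] with x hx using hpt x hx
    _ = C1 ^ r * N ^ (r - 1) * ∫⁻ y, ∫⁻ x, F x y ∂μ ∂μ := by
        rw [lintegral_const_mul' _ _ hc1, lintegral_lintegral_swap hFm.aemeasurable]
    _ ≤ C1 ^ r * N ^ (r - 1) * ∫⁻ y, C2 * φ y ∂μ := by
        refine mul_le_mul' le_rfl (lintegral_mono_ae ?_)
        filter_upwards [hE0] with y hy using hin y hy
    _ = C1 ^ r * C2 * (N ^ (r - 1) * N) := by
        rw [lintegral_const_mul' _ _ hC2]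
        ring
    _ = C1 ^ r * C2 * N ^ r := by
        congr 1
        nth_rewrite 2 [← ENNReal.rpow_one N]
        rw [← ENNReal.rpow_add_of_nonneg _ _ (by linarith) (by norm_num), sub_add_cancel]

lemma local_part {μ : Measure X} [SecondCountableTopology X] [SFinite μ]
    (hb : BallsPosFinite μ) {K : ℝ≥0∞} (hKt : K ≠ ∞) (hK0 : K ≠ 0)
    (hK : ∀ (x : X) (r : ℝ), 0 < r → μ (ball x (2 * r)) ≤ K * μ (ball x r))
    {Q c : ℝ} (hQ : 0 < Q) (hc : 0 < c)
    (hlow : ∀ (x : X) (r : ℝ), 0 < r → ENNReal.ofReal (c * r ^ Q) ≤ μ (ball x r))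
    {E : Set X} (hE0 : ∀ᵐ y ∂μ, 0 < infDist y E)
    {s p q β : ℝ} (hs : 0 < s) (hp : 1 < p) (hpq : p ≤ q) (hsp : s * p < Q)
    (hκ : 0 ≤ Q + q * s - q * Q / p) :
    ∃ C : ℝ≥0∞, C ≠ ∞ ∧ ∀ f : X → ℝ≥0∞, Measurable f → ∫⁻ x, f x ^ p * wt E β x ∂μ ≠ ∞ →
      ∫⁻ x, (∫⁻ y in {y | 0 < dist x y ∧ dist x y ≤ infDist x E / 2},
          ker μ s x y * f y ∂μ) ^ q * wt E (q / p * (Q - s * p + β) - Q) x ∂μ ≤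
        C * (∫⁻ x, f x ^ p * wt E β x ∂μ) ^ (q / p) := by
  have hp0 : 0 < p := by linarith
  have hq0 : 0 < q := by linarith
  obtain ⟨C1, hC1, H1⟩ := strong_type hb hK hQ hc hlow hKt hK0 hp
  obtain ⟨A1, hA1, HA1⟩ := ker_far hb hKt hK hc hlow hp hsp
  set A2 : ℝ≥0∞ := (ENNReal.ofReal (2 ^ |s|) * K ^ 2) * (1 - ENNReal.ofReal ((2 : ℝ) ^ (-s)))⁻¹
    with hA2
  have hA2t : A2 ≠ ∞ := ENNReal.mul_ne_top (ENNReal.mul_ne_top ENNReal.ofReal_ne_top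
    (ENNReal.pow_ne_top hKt)) (geom_const_ne_top (by linarith))
  set A := A1 + A2 + 1 with hA
  have hAt : A ≠ ∞ := by rw [hA]; simp [hA1, hA2t]
  have hA0 : A ≠ 0 := by rw [hA]; simp
  have hA1A : A1 ≤ A := by rw [hA, add_assoc]; exact le_self_add
  have hA2A : A2 ≤ A := by
    rw [hA, add_comm A1, add_assoc]; exact le_self_add
  set B : ℝ≥0∞ := ENNReal.ofReal (2 ^ |-(β / p)|) ^ q with hB
  have hBt : B ≠ ∞ := ENNReal.rpow_ne_top_of_nonneg hq0.le ENNReal.ofReal_ne_top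
  have h2At : (2 * A) ^ q ≠ ∞ :=
    ENNReal.rpow_ne_top_of_nonneg hq0.le (ENNReal.mul_ne_top (by norm_num) hAt)
  refine ⟨B * (2 * A) ^ q * C1, ENNReal.mul_ne_top (ENNReal.mul_ne_top hBt h2At) hC1, ?_⟩
  intro f hf hNt
  set N := ∫⁻ x, f x ^ p * wt E β x ∂μ with hN
  set g : X → ℝ≥0∞ := fun y => f y * wt E (β / p) y with hg
  have hgm : Measurable g := hf.mul (measurable_wt E _)
  have hgN : ∫⁻ y, g y ^ p ∂μ = N := by
    refine lintegral_congr_ae ?_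
    filter_upwards [hE0] with y hy
    rw [hg]
    simp only
    rw [ENNReal.mul_rpow_of_nonneg _ _ hp0.le, wt_pow hy, div_mul_cancel₀ _ hp0.ne']
  set P : X → ℝ≥0∞ := fun x => ∫⁻ y in {y | 0 < dist x y ∧ dist x y ≤ infDist x E / 2},
    ker μ s x y * g y ∂μ with hP
  have hDm : ∀ (x : X) (t : ℝ), MeasurableSet {y : X | 0 < dist x y ∧ dist x y ≤ t} := by
    intro x t
    have hd : Measurable fun y : X => dist x y := (by fun_prop : Continuous _).measurable
    exact (measurableSet_lt measurable_const hd).inter (measurableSet_le hd measurable_const)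
  have hnear : ∀ (x : X) (t : ℝ), 0 < t →
      ∫⁻ y in {y | 0 < dist x y ∧ dist x y ≤ t}, ker μ s x y * g y ∂μ ≤
        A * (maxFn μ g x * ENNReal.ofReal (t ^ s)) := by
    intro x t ht
    have h := near_bound hb hK g x hs.le (maxFn μ g x) ht (fun t ht => le_maxFn hb g x ht)
    refine h.trans ?_
    calc _ = A2 * (maxFn μ g x * ENNReal.ofReal (t ^ s)) := by rw [hA2]; ring
      _ ≤ _ := by gcongr
  have hL : ∀ x, 0 < infDist x E →
      ∫⁻ y in {y | 0 < dist x y ∧ dist x y ≤ infDist x E / 2}, ker μ s x y * f y ∂μ ≤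
        ENNReal.ofReal (2 ^ |-(β / p)|) * wt E (-(β / p)) x * P x := by
    intro x hx
    rw [hP]
    simp only
    rw [← lintegral_const_mul' _ _ (ENNReal.mul_ne_top ENNReal.ofReal_ne_top (wt_ne_top E _ x))]
    refine setLIntegral_mono' (hDm x _) fun y hy => ?_
    obtain ⟨hy1, hy2⟩ := hy
    have t1 := infDist_le_infDist_add_dist (s := E) (x := x) (y := y)
    have t2 := infDist_le_infDist_add_dist (s := E) (x := y) (y := x)
    rw [dist_comm y x] at t2
    have hy0 : 0 < infDist y E := by linarith
    have hc := rpow_comp (t := infDist x E) (d := infDist y E) (-(β / p)) hx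
      (by linarith) (by linarith)
    have hw : wt E (-(β / p)) y ≤ ENNReal.ofReal (2 ^ |-(β / p)|) * wt E (-(β / p)) x := by
      unfold wt
      rw [← ENNReal.ofReal_mul (by positivity)]
      exact ENNReal.ofReal_le_ofReal hc
    calc ker μ s x y * f y = wt E (-(β / p)) y * (ker μ s x y * g y) := by
          have : wt E (β / p) y * wt E (-(β / p)) y = 1 := by
            rw [wt_mul hy0, add_neg_cancel, wt_zero]
          rw [hg]
          simp only
          calc _ = ker μ s x y * f y * (wt E (β / p) y * wt E (-(β / p)) y) := by
                rw [this, mul_one]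
            _ = _ := by ring
      _ ≤ _ := by gcongr
  have hpt : ∀ x, 0 < infDist x E →
      (∫⁻ y in {y | 0 < dist x y ∧ dist x y ≤ infDist x E / 2}, ker μ s x y * f y ∂μ) ^ q *
        wt E (q / p * (Q - s * p + β) - Q) x ≤
      B * (2 * A) ^ q * N ^ (q / p - 1) * maxFn μ g x ^ p := by
    intro x hx
    have hhed : P x ^ q * ENNReal.ofReal (infDist x E ^ (-(Q + q * s - q * Q / p))) ≤
        (2 * A) ^ q * (N ^ (q / p - 1) * maxFn μ g x ^ p) := by
      refine hedberg_real hx hA0 hp hpq hQ hs hκ hNt ?_ ?_ ?_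
      · intro h0
        rw [← hgN, lintegral_eq_zero_iff (hgm.pow_const _)] at h0
        rw [hP]
        simp only
        have : ∫⁻ y, ker μ s x y * g y ∂μ = 0 := by
          refine (lintegral_eq_zero_iff ((measurable_ker_right μ s x).mul hgm)).2 ?_
          filter_upwards [h0] with y hy
          have : g y = 0 := by
            have hy' : g y ^ p = 0 := hy
            rwa [ENNReal.rpow_eq_zero_iff_of_pos hp0] at hy'
          change ker μ s x y * g y = 0
          rw [this, mul_zero]
        exact le_antisymm ((setLIntegral_le_lintegral _ _).trans this.le) zero_le
      · intro r hr
        calc P x ≤ ∫⁻ y in {y | 0 < dist x y ∧ dist x y ≤ r} ∪ {y | r ≤ dist x y},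
              ker μ s x y * g y ∂μ := by
              refine lintegral_mono_set fun y hy => ?_
              rcases le_total (dist x y) r with h | h
              · exact Or.inl ⟨hy.1, h⟩
              · exact Or.inr h
          _ ≤ _ := lintegral_union_le _ _ _
          _ ≤ _ := by
              refine add_le_add (hnear x r hr) ((HA1 g hgm x r hr).trans ?_)
              rw [hgN]
              gcongr
      · refine (hnear x _ (by positivity)).trans ?_
        gcongr
        linarith
    calc _ ≤ (ENNReal.ofReal (2 ^ |-(β / p)|) * wt E (-(β / p)) x * P x) ^ q *
          wt E (q / p * (Q - s * p + β) - Q) x := by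
          gcongr
          exact hL x hx
      _ = B * (P x ^ q * (wt E (-(β / p) * q) x * wt E (q / p * (Q - s * p + β) - Q) x)) := by
          rw [ENNReal.mul_rpow_of_nonneg _ _ hq0.le, ENNReal.mul_rpow_of_nonneg _ _ hq0.le,
            wt_pow hx]
          ring
      _ = B * (P x ^ q * ENNReal.ofReal (infDist x E ^ (-(Q + q * s - q * Q / p)))) := by
          rw [wt_mul hx, show -(β / p) * q + (q / p * (Q - s * p + β) - Q) =
            -(Q + q * s - q * Q / p) by field_simp; ring]
          rfl
      _ ≤ B * ((2 * A) ^ q * (N ^ (q / p - 1) * maxFn μ g x ^ p)) := by gcongr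
      _ = _ := by ring
  have hqp : 0 ≤ q / p - 1 := by rw [sub_nonneg, le_div_iff₀ hp0]; linarith
  have hct : B * (2 * A) ^ q * N ^ (q / p - 1) ≠ ∞ :=
    ENNReal.mul_ne_top (ENNReal.mul_ne_top hBt h2At) (ENNReal.rpow_ne_top_of_nonneg hqp hNt)
  calc _ ≤ ∫⁻ x, B * (2 * A) ^ q * N ^ (q / p - 1) * maxFn μ g x ^ p ∂μ := by
        refine lintegral_mono_ae ?_
        filter_upwards [hE0] with x hx using hpt x hx
    _ = B * (2 * A) ^ q * N ^ (q / p - 1) * ∫⁻ x, maxFn μ g x ^ p ∂μ :=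
        lintegral_const_mul' _ _ hct
    _ ≤ B * (2 * A) ^ q * N ^ (q / p - 1) * (C1 * N) := by
        rw [← hgN] at *
        gcongr
        exact H1 g hgm
    _ = B * (2 * A) ^ q * C1 * (N ^ (q / p - 1) * N) := by ring
    _ = B * (2 * A) ^ q * C1 * N ^ (q / p) := by
        congr 1
        nth_rewrite 2 [← ENNReal.rpow_one N]
        rw [← ENNReal.rpow_add_of_nonneg _ _ hqp (by norm_num), sub_add_cancel]

lemma ae_pos_infDist {μ : Measure X} (hb : BallsPosFinite μ)
    {E : Set X} (hE : E.Nonempty) (hEc : IsClosed E) {ρ : ℝ} (A : ℝ)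
    (hρ : ∀ x ∈ E, ∀ r R : ℝ, 0 < r → r < R →
      μ ({y : X | infDist y E < r} ∩ ball x R) ≤
      ENNReal.ofReal (A * (r / R) ^ ρ) * μ (ball x R)) (hρ0 : 0 < ρ) :
    ∀ᵐ y ∂μ, 0 < infDist y E := by
  obtain ⟨x0, hx0⟩ := hE
  have h1 : ∀ n : ℕ, μ (E ∩ ball x0 (n + 1)) = 0 := by
    intro n
    have hR : (0 : ℝ) < n + 1 := by positivity
    have hlim : Filter.Tendsto (fun r : ℝ => ENNReal.ofReal (A * (r / (n + 1)) ^ ρ) *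
        μ (ball x0 (n + 1))) (nhdsWithin 0 (Ioi 0)) (nhds 0) := by
      have hc : Continuous fun r : ℝ => A * (r / (n + 1)) ^ ρ :=
        continuous_const.mul ((continuous_id.div_const _).rpow_const fun _ => Or.inr hρ0.le)
      have h := (ENNReal.continuous_ofReal.comp hc).tendsto 0
      have h0 : (ENNReal.ofReal ∘ fun r : ℝ => A * (r / (n + 1)) ^ ρ) 0 = 0 := by
        simp [Real.zero_rpow hρ0.ne']
      rw [h0] at h
      have h3 := ENNReal.Tendsto.mul_const (h.mono_left (nhdsWithin_le_nhds (s := Ioi 0)))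
        (Or.inr (hb x0 _ hR).2.ne)
      simpa using h3
    refine le_antisymm (ge_of_tendsto hlim ?_) zero_le
    filter_upwards [Ioo_mem_nhdsGT hR] with r hr
    refine le_trans (measure_mono ?_) (hρ x0 hx0 r _ hr.1 hr.2)
    intro y hy
    refine ⟨?_, hy.2⟩
    change infDist y E < r
    rw [infDist_zero_of_mem hy.1]
    exact hr.1
  have h2 : μ E = 0 := by
    refine measure_mono_null ?_ (measure_iUnion_null h1)
    intro y hy
    obtain ⟨n, hn⟩ := exists_nat_gt (dist y x0)
    exact mem_iUnion.2 ⟨n, hy, by rw [mem_ball]; linarith⟩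
  filter_upwards [measure_eq_zero_iff_ae_notMem.1 h2] with y hy
  exact (hEc.notMem_iff_infDist_pos ⟨x0, hx0⟩).1 hy

theorem rieszPotential_hardy_sobolev [Nontrivial X]
    (μ : Measure X) (s : ℝ) (hs : 0 < s)
    (hsa : StandingAssumptions μ) (hballs : BallsPosFinite μ) (hdbl : Doubling μ)
    (hrev : ReverseDoubling μ s)
    (Q c : ℝ) (hQ : s < Q) (hc : 0 < c)
    (hlow : ∀ (x : X) (r : ℝ), 0 < r → ENNReal.ofReal (c * r ^ Q) ≤ μ (ball x r))
    (E : Set X) (hE : E.Nonempty) (hEc : IsClosed E)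
    (p q β : ℝ) (hp : 1 < p) (hpq : p ≤ q) (hsp : s * p < Q)
    (hq : q ≤ Q * p / (Q - s * p))
    (hcodim : max (Q - q / p * (Q - s * p + β)) (β / (p - 1)) < assouadCodim μ E) :
    ∃ C : ℝ, 0 < C ∧ ∀ f : X → ℝ≥0∞, Measurable f →
      (∫⁻ x, rieszPotential μ s f x ^ q *
          ENNReal.ofReal (infDist x E) ^ (q / p * (Q - s * p + β) - Q) ∂μ) ^ (1 / q) ≤
        ENNReal.ofReal C *
          (∫⁻ x, f x ^ p * ENNReal.ofReal (infDist x E) ^ β ∂μ) ^ (1 / p) := by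
  classical
  haveI : SigmaFinite μ := sigmaFinite_of_balls hballs
  haveI : SecondCountableTopology X := secondCountable_of_balls hballs
  obtain ⟨hunb, hpts, -⟩ := hsa
  obtain ⟨CD, hCD, hdb⟩ := hdbl
  have hp0 : 0 < p := by linarith
  have hq0 : 0 < q := by linarith
  have hQ0 : 0 < Q := by linarith
  have hp1 : 0 < p - 1 := by linarith
  have hKt : ENNReal.ofReal CD ≠ ∞ := ENNReal.ofReal_ne_top
  have hK0 : ENNReal.ofReal CD ≠ 0 := by simpa using hCD
  have hK : ∀ (x : X) (r : ℝ), 0 < r → μ (ball x (2 * r)) ≤ ENNReal.ofReal CD * μ (ball x r) := hdb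
  have hq' : q * (Q - s * p) ≤ Q * p := by
    rwa [le_div_iff₀ (by linarith)] at hq
  have hκe : Q + q * s - q * Q / p = (Q * p - q * (Q - s * p)) / p := by field_simp; ring
  have hκ : 0 ≤ Q + q * s - q * Q / p := by
    rw [hκe]; exact div_nonneg (by linarith) hp0.le
  obtain ⟨ρ, ⟨hρ0, A, hA1, hρ'⟩, hρm⟩ := exists_lt_of_lt_csSup
    (⟨0, le_rfl, 1, le_rfl, fun x _ r R _ _ _ => by
      simpa using measure_mono inter_subset_right⟩ : (assouadCodimBddSet μ E).Nonempty) hcodim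
  obtain ⟨hm1, hm2⟩ := max_lt_iff.1 hρm
  have hρ : ∀ x ∈ E, ∀ r R : ℝ, 0 < r → r < R →
      μ ({y : X | infDist y E < r} ∩ ball x R) ≤
      ENNReal.ofReal (A * (r / R) ^ ρ) * μ (ball x R) := by
    intro x hx r R hr hrR
    refine hρ' x hx r R hr hrR ?_
    have : EMetric.diam (univ : Set X) = ∞ := by
      by_contra h
      exact hunb (Metric.isBounded_iff_ediam_ne_top.2 h)
    rw [this, ENNReal.mul_top (by norm_num)]
    exact ENNReal.ofReal_lt_top
  have hρpos : 0 < ρ := by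
    rcases le_or_gt 0 β with h | h
    · exact lt_of_le_of_lt (div_nonneg h hp1.le) hm2
    · refine lt_trans ?_ hm1
      have e : Q - q / p * (Q - s * p + β) = (Q * p - q * (Q - s * p)) / p + q / p * (-β) := by
        field_simp; ring
      rw [e]
      have h1 : 0 ≤ (Q * p - q * (Q - s * p)) / p := div_nonneg (by linarith) hp0.le
      have h2 : 0 < q / p * (-β) := mul_pos (by positivity) (by linarith)
      linarith
  have hE0 : ∀ᵐ y ∂μ, 0 < infDist y E := ae_pos_infDist hballs hE hEc A hρ hρpos
  obtain ⟨C1, hC1, H1⟩ := local_part (β := β) hballs hKt hK0 hK hQ0 hc hlow hE0 hs hp hpq hsp hκ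
  obtain ⟨C2, hC2, H2⟩ := nonlocal_part hballs hKt hK hc hlow hE hE0 A hρ (by linarith) hp hpq
    hm1 hm2
  set D : ℝ≥0∞ := 2 ^ (q - 1) * (C1 + C2) with hD
  have h2t : (2 : ℝ≥0∞) ^ (q - 1) ≠ ∞ :=
    ENNReal.rpow_ne_top_of_nonneg (by linarith) (by norm_num)
  have hDt : D ≠ ∞ := ENNReal.mul_ne_top h2t (ENNReal.add_ne_top.2 ⟨hC1, hC2⟩)
  have hDqt : D ^ (1 / q) ≠ ∞ := ENNReal.rpow_ne_top_of_nonneg (by positivity) hDt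
  refine ⟨(D ^ (1 / q)).toReal + 1, by positivity, ?_⟩
  intro f hf
  have hwt : ∀ b : ℝ, ∀ x, 0 < infDist x E → ENNReal.ofReal (infDist x E) ^ b = wt E b x :=
    fun b x hx => by rw [wt, ENNReal.ofReal_rpow_of_pos hx]
  have hNe : ∫⁻ x, f x ^ p * ENNReal.ofReal (infDist x E) ^ β ∂μ =
      ∫⁻ x, f x ^ p * wt E β x ∂μ := by
    refine lintegral_congr_ae ?_
    filter_upwards [hE0] with x hx
    rw [hwt _ x hx]
  rw [hNe]
  set N := ∫⁻ x, f x ^ p * wt E β x ∂μ with hN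
  rcases eq_or_ne N ∞ with hNt | hNt
  · rw [hNt, ENNReal.top_rpow_of_pos (by positivity), ENNReal.mul_top]
    · exact le_top
    · rw [Ne, ENNReal.ofReal_eq_zero, not_le]; positivity
  have hmain : ∫⁻ x, rieszPotential μ s f x ^ q *
      ENNReal.ofReal (infDist x E) ^ (q / p * (Q - s * p + β) - Q) ∂μ ≤ D * N ^ (q / p) := by
    set a := q / p * (Q - s * p + β) - Q with ha
    set L : X → ℝ≥0∞ := fun x => ∫⁻ y in {y | 0 < dist x y ∧ dist x y ≤ infDist x E / 2},
          ker μ s x y * f y ∂μ with hL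
    set G : X → ℝ≥0∞ := fun x => ∫⁻ y in {y | infDist x E / 2 ≤ dist x y},
          ker μ s x y * f y ∂μ with hG
    have hLm : Measurable L := by
      set T : Set (X × X) := {z | 0 < dist z.1 z.2 ∧ dist z.1 z.2 ≤ infDist z.1 E / 2} with hT
      have hTm : MeasurableSet T := by
        have hd : Measurable fun z : X × X => dist z.1 z.2 :=
          (by fun_prop : Continuous _).measurable
        have hi : Measurable fun z : X × X => infDist z.1 E / 2 :=
          ((measurable_infDist (s := E)).comp measurable_fst).div_const 2
        exact (measurableSet_lt measurable_const hd).inter (measurableSet_le hd hi)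
      have hm : Measurable (T.indicator fun z : X × X => ker μ s z.1 z.2 * f z.2) :=
        ((measurable_ker μ s).mul (hf.comp measurable_snd)).indicator hTm
      have hm' := hm.lintegral_prod_right' (ν := μ)
      convert hm' using 2 with x
      have hS : MeasurableSet {y : X | 0 < dist x y ∧ dist x y ≤ infDist x E / 2} :=
        measurable_prodMk_left hTm
      rw [hL]
      simp only
      rw [← lintegral_indicator hS]
      rfl
    have hI : ∀ x, rieszPotential μ s f x ≤ L x + G x := by
      intro x
      have e : rieszPotential μ s f x = ∫⁻ y in univ, ker μ s x y * f y ∂μ := by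
        rw [Measure.restrict_univ]
        refine lintegral_congr fun y => ?_
        rw [ker, div_eq_mul_inv, div_eq_mul_inv]
        ring
      rw [e]
      calc _ ≤ ∫⁻ y in {x} ∪ ({y | 0 < dist x y ∧ dist x y ≤ infDist x E / 2} ∪
              {y | infDist x E / 2 ≤ dist x y}), ker μ s x y * f y ∂μ := by
            refine lintegral_mono_set fun y _ => ?_
            rcases eq_or_ne y x with h | h
            · exact Or.inl h
            · rcases le_total (dist x y) (infDist x E / 2) with h' | h'
              · exact Or.inr (Or.inl ⟨dist_pos.2 h.symm, h'⟩)
              · exact Or.inr (Or.inr h')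
        _ ≤ _ := lintegral_union_le _ _ _
        _ = ∫⁻ y in ({y | 0 < dist x y ∧ dist x y ≤ infDist x E / 2} ∪
              {y | infDist x E / 2 ≤ dist x y}), ker μ s x y * f y ∂μ := by
            rw [Measure.restrict_eq_zero.2 (hpts x), lintegral_zero_measure, zero_add]
        _ ≤ _ := lintegral_union_le _ _ _
    calc _ ≤ ∫⁻ x, 2 ^ (q - 1) * (L x ^ q * wt E a x + G x ^ q * wt E a x) ∂μ := by
          refine lintegral_mono_ae ?_
          filter_upwards [hE0] with x hx
          rw [hwt _ x hx, ← add_mul, ← mul_assoc]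
          gcongr
          exact (ENNReal.rpow_le_rpow (hI x) hq0.le).trans
            (ENNReal.rpow_add_le_mul_rpow_add_rpow _ _ (by linarith))
      _ = 2 ^ (q - 1) * (∫⁻ x, L x ^ q * wt E a x ∂μ + ∫⁻ x, G x ^ q * wt E a x ∂μ) := by
          have hLw : Measurable fun x => L x ^ q * wt E a x :=
            (hLm.pow_const _).mul (measurable_wt E a)
          rw [lintegral_const_mul' _ _ h2t, lintegral_add_left hLw]
      _ ≤ 2 ^ (q - 1) * (C1 * N ^ (q / p) + C2 * N ^ (q / p)) :=
          mul_le_mul' le_rfl (add_le_add (H1 f hf hNt) (H2 f hf hNt))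
      _ = _ := by rw [hD]; ring
  calc _ ≤ (D * N ^ (q / p)) ^ (1 / q) := ENNReal.rpow_le_rpow hmain (by positivity)
    _ = D ^ (1 / q) * N ^ (1 / p) := by
        rw [ENNReal.mul_rpow_of_nonneg _ _ (by positivity), ← ENNReal.rpow_mul]
        congr 2
        field_simp
    _ ≤ _ := by
        gcongr
        calc D ^ (1 / q) = ENNReal.ofReal (D ^ (1 / q)).toReal := (ENNReal.ofReal_toReal hDqt).symm
          _ ≤ _ := ENNReal.ofReal_le_ofReal (by linarith)

end
end ApDistance
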